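/- Let G be an Artin group on generators a₁,…,aₙ with all labels m_{ij} ≥ 7. Then G is relatively hyperbolic in the sense of Farb with respect to the collection of its two-generator parabolic subgroups {G_{ij} = ⟨a_i, a_j⟩ : m_{ij} < ∞}; that is, the coned-off Cayley graph of G with respect to these subgroups is a Gromov-hyperbolic metric space. -/

import Mathlib

/-- Vertices of the coned-off Cayley graph `Γ̂_A(G; H)`: the elements of `G`
(vertices of the Cayley graph) together with one cone vertex `v(gHᵢ)` for each
coset of each subgroup `Hᵢ`. -/
inductive ConedVert (G : Type*) [Group G] {ι : Type*} (H : ι → Subgroup G) : Type _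
  | grp : G → ConedVert G H
  | cone : (i : ι) → G ⧸ H i → ConedVert G H

/-- Adjacency in the coned-off Cayley graph: Cayley-graph edges between group
elements differing by a generator in `A`, and cone edges between a cone vertex
`v(gHᵢ)` and the elements of the coset `gHᵢ`. -/
def conedAdj {G : Type*} [Group G] {ι : Type*} (A : Set G) (H : ι → Subgroup G) :
    ConedVert G H → ConedVert G H → Prop
  | .grp g, .grp g' => ∃ a ∈ A, g' = g * a ∨ g = g' * a
  | .grp g, .cone i c => (QuotientGroup.mk g : G ⧸ H i) = c
  | .cone i c, .grp g => (QuotientGroup.mk g : G ⧸ H i) = c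
  | .cone _ _, .cone _ _ => False

/-- Edge lengths in the coned-off Cayley graph: Cayley edges have length `1`,
cone edges have length `1/2`. -/
noncomputable def conedWt {G : Type*} [Group G] {ι : Type*} (H : ι → Subgroup G) :
    ConedVert G H → ConedVert G H → ℝ
  | .grp _, .grp _ => 1
  | _, _ => 1 / 2

/-- The length of an edge path, given edge lengths `w`. -/
noncomputable def pathCost {V : Type*} (w : V → V → ℝ) : List V → ℝ
  | x :: y :: l => w x y + pathCost w (y :: l)
  | _ => 0

/-- `p` is an edge path from `x` to `y` for the adjacency relation `Adj`. -/
def IsPathFrom {V : Type*} (Adj : V → V → Prop) (p : List V) (x y : V) : Prop :=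
  p.head? = some x ∧ p.getLast? = some y ∧ p.Chain' Adj

/-- The path metric of the coned-off Cayley graph `Γ̂_A(G; H)`: the infimum of the
lengths of edge paths joining two vertices. -/
noncomputable def conedDist {G : Type*} [Group G] {ι : Type*} (A : Set G)
    (H : ι → Subgroup G) (x y : ConedVert G H) : ℝ :=
  sInf { c | ∃ p, IsPathFrom (conedAdj A H) p x y ∧ pathCost (conedWt H) p = c }

/-- A distance function is Gromov-hyperbolic if it satisfies the four-point
condition: `d(x,y) + d(z,w) ≤ max (d(x,z) + d(y,w)) (d(x,w) + d(y,z)) + δ`. -/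
def IsGromovHyperbolicDist {V : Type*} (d : V → V → ℝ) : Prop :=
  ∃ δ : ℝ, 0 ≤ δ ∧ ∀ x y z w, d x y + d z w ≤ max (d x z + d y w) (d x w + d y z) + δ

/-- The alternating word `x y x y ⋯` with `m` letters, in the free group. -/
def altWord {σ : Type*} (x y : σ) : ℕ → FreeGroup σ
  | 0 => 1
  | m + 1 => FreeGroup.of x * altWord y x m

/-- The defining relators `u_{ij} u_{ji}⁻¹` of the Artin group with Coxeter-type
labels `M : Fin n → Fin n → ℕ∞` (relations with `M i j = ∞` are omitted). -/
def artinRels (n : ℕ) (M : Fin n → Fin n → ℕ∞) : Set (FreeGroup (Fin n)) :=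
  { r | ∃ i j : Fin n, i ≠ j ∧ ∃ m : ℕ, M i j = (m : ℕ∞) ∧
      r = altWord i j m * (altWord j i m)⁻¹ }

/-- The quotient map from the free group onto the Artin group with labels `M`. -/
def artinMk (n : ℕ) (M : Fin n → Fin n → ℕ∞) :
    FreeGroup (Fin n) →* PresentedGroup (artinRels n M) :=
  PresentedGroup.mk _

/-- The index type of the non-free two-generator parabolic subgroups: pairs
`i < j` with `m_{ij} < ∞`. -/
def FinitePairs (n : ℕ) (M : Fin n → Fin n → ℕ∞) : Type :=
  { p : Fin n × Fin n // p.1 < p.2 ∧ M p.1 p.2 ≠ ⊤ }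

/-- The parabolic subgroup `G_{ij} = ⟨a_i, a_j⟩` for a pair with `m_{ij} < ∞`. -/
def parabolic (n : ℕ) (M : Fin n → Fin n → ℕ∞) (p : FinitePairs n M) :
    Subgroup (PresentedGroup (artinRels n M)) :=
  Subgroup.closure {artinMk n M (FreeGroup.of p.1.1), artinMk n M (FreeGroup.of p.1.2)}

namespace VK

/-- inverse letter -/
def ib {α : Type} (e : α × Bool) : α × Bool := (e.1, !e.2)

theorem ib_ib {α : Type} (e : α × Bool) : ib (ib e) = e := by simp [ib]

/-- derivations of van Kampen type -/
inductive D {α : Type} (R : List (α × Bool) → Prop) : ℕ → List (α × Bool) → Prop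
  | nil : D R 0 []
  | fold {k l : ℕ} {e : α × Bool} {u v : List (α × Bool)} :
      D R k u → D R l v → D R (k + l) (e :: (u ++ ib e :: v))
  | cell {k : ℕ} {e : α × Bool} {s x : List (α × Bool)} :
      R (ib e :: s) → D R k (s ++ x) → D R (k + 1) (e :: x)

theorem split_lem {β : Type} {x s u v : List β} {f : β} (h : x ++ s = u ++ f :: v) :
    (∃ b, x = u ++ f :: b ∧ v = b ++ s) ∨ (∃ a, u = x ++ a ∧ s = a ++ f :: v) := by
  rcases List.append_eq_append_iff.1 h with ⟨a, h1, h2⟩ | ⟨b, h1, h2⟩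
  · exact Or.inr ⟨a, h1, h2⟩
  · cases b with
    | nil => right; exact ⟨[], by simpa using h1.symm, by simpa using h2.symm⟩
    | cons c b =>
      simp only [List.cons_append, List.cons.injEq] at h2
      left; exact ⟨b, by rw [h1, h2.1], h2.2⟩

section
variable {α : Type} {R : List (α × Bool) → Prop}

theorem D.append {k l : ℕ} {u v : List (α × Bool)} (hu : D R k u) (hv : D R l v) :
    D R (k + l) (u ++ v) := by
  induction hu with
  | nil => simpa using hv
  | @fold k1 l1 e u' v' h1 h2 ih1 ih2 =>
    have := D.fold (e := e) h1 ih2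
    simpa [add_assoc] using this
  | @cell k1 e s x hR h ih =>
    have := D.cell (e := e) (s := s) (x := x ++ v) hR (by simpa using ih)
    rw [show k1 + 1 + l = k1 + l + 1 by ring]
    simpa using this

theorem last_cell (hrot : ∀ a b, R (a ++ b) → R (b ++ a)) (K : ℕ)
    (hK : ∀ k ≤ K, ∀ a b, D R k (a ++ b) → D R k (b ++ a))
    {e : α × Bool} {s : List (α × Bool)} (hR : R (ib e :: s)) :
    ∀ k w, D R k w → k ≤ K → ∀ x, w = x ++ s → D R (k + 1) (x ++ [e]) := by
  intro k w h
  have base : ∀ k, D R k s → D R (k + 1) ([] ++ [e]) := fun k hs =>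
    D.cell hR (by simpa using hs)
  induction h with
  | nil =>
    intro _ x hx
    have := List.append_eq_nil_iff.1 hx.symm
    rw [this.1]; apply base; rw [this.2]; exact D.nil
  | @fold k l f u v h1 h2 ih1 ih2 =>
    intro hk x hx
    cases x with
    | nil => apply base; rw [← List.nil_append s, ← hx]; exact D.fold h1 h2
    | cons g x =>
      simp only [List.cons_append, List.cons.injEq] at hx
      obtain ⟨rfl, hx⟩ := hx
      rcases split_lem hx.symm with ⟨b, h3, h4⟩ | ⟨a, h3, h4⟩
      · have := D.fold (e := f) h1 (ih2 (by omega) b h4)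
        rw [h3]
        simpa [add_assoc] using this
      · have hR' : R (ib f :: (v ++ ib e :: a)) := by
          have := hrot (ib e :: a) (ib f :: v) (by simpa [h4] using hR)
          simpa using this
        have h5 := hK k (by omega) x a (by rw [← h3]; exact h1)
        have h6 := h2.append (D.fold (e := ib e) h5 D.nil)
        have := D.cell (x := x ++ [e]) hR' (k := k + l) (by
          rw [add_comm]; simpa [ib_ib] using h6)
        simpa using this
  | @cell k f t y hR1 h ih =>
    intro hk x hx
    cases x with
    | nil => apply base; rw [← List.nil_append s, ← hx]; exact D.cell hR1 h
    | cons g x =>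
      simp only [List.cons_append, List.cons.injEq] at hx
      obtain ⟨rfl, hx⟩ := hx
      have := ih (by omega) (t ++ x) (by rw [hx]; simp)
      exact D.cell hR1 (by simpa using this)

theorem rot_full {k : ℕ} (h1 : ∀ (e : α × Bool) x, D R k (e :: x) → D R k (x ++ [e])) :
    ∀ a b, D R k (a ++ b) → D R k (b ++ a) := by
  intro a
  induction a with
  | nil => intro b h; simpa using h
  | cons e a ih =>
    intro b h
    have := ih (b ++ [e]) (by simpa using h1 e _ h)
    simpa using this

theorem D.rot (hrot : ∀ a b, R (a ++ b) → R (b ++ a)) :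
    ∀ k, ∀ a b, D R k (a ++ b) → D R k (b ++ a) := by
  intro k
  induction k using Nat.strong_induction_on with
  | _ k IH =>
    apply rot_full
    intro e x h
    generalize hw : e :: x = w at h
    cases h with
    | nil => simp at hw
    | @fold k l f u v h1 h2 =>
      simp only [List.cons.injEq] at hw
      obtain ⟨rfl, rfl⟩ := hw
      have := h1.append (D.fold (e := ib e) h2 D.nil)
      simpa [ib_ib] using this
    | @cell k f t y hR1 h =>
      simp only [List.cons.injEq] at hw
      obtain ⟨rfl, rfl⟩ := hw
      exact last_cell hrot k (fun k' hk' => IH k' (by omega)) hR1 k _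
        (IH k (by omega) _ _ h) le_rfl x rfl

theorem bubble (hrot : ∀ a b, R (a ++ b) → R (b ++ a)) {r : List (α × Bool)} (hR : R r) :
    ∀ k w, D R k w → ∀ x, w = x ++ r → ∃ j ≤ k + 1, D R j x := by
  intro k w h
  induction h with
  | nil =>
    intro x hx
    have := List.append_eq_nil_iff.1 hx.symm
    rw [this.1]; exact ⟨0, by omega, D.nil⟩
  | @fold k l f u v h1 h2 ih1 ih2 =>
    intro x hx
    cases x with
    | nil => exact ⟨0, by omega, D.nil⟩
    | cons g x =>
      simp only [List.cons_append, List.cons.injEq] at hx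
      obtain ⟨rfl, hx⟩ := hx
      rcases split_lem hx.symm with ⟨b, h3, h4⟩ | ⟨a, h3, h4⟩
      · obtain ⟨j, hj, h5⟩ := ih2 b h4
        rw [h3]
        exact ⟨k + j, by omega, D.fold h1 h5⟩
      · have hR' : R (ib f :: (v ++ a)) := by
          have := hrot a (ib f :: v) (by simpa [h4] using hR)
          simpa using this
        have h5 := D.rot hrot k x a (by rw [← h3]; exact h1)
        exact ⟨l + k + 1, by omega, D.cell hR' (by simpa using h2.append h5)⟩
  | @cell k f t y hR1 h ih =>
    intro x hx
    cases x with
    | nil => exact ⟨0, by omega, D.nil⟩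
    | cons g x =>
      simp only [List.cons_append, List.cons.injEq] at hx
      obtain ⟨rfl, hx⟩ := hx
      obtain ⟨j, hj, h5⟩ := ih (t ++ x) (by rw [hx]; simp)
      exact ⟨j + 1, by omega, D.cell hR1 h5⟩

theorem D.delete (hrot : ∀ a b, R (a ++ b) → R (b ++ a)) {k : ℕ} {e : α × Bool}
    {x : List (α × Bool)} (h : D R k (e :: ib e :: x)) : ∃ j ≤ k, D R j x := by
  generalize hw : e :: ib e :: x = w at h
  cases h with
  | nil => simp at hw
  | @fold k l f u v h1 h2 =>
    simp only [List.cons.injEq] at hw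
    obtain ⟨rfl, hw⟩ := hw
    cases u with
    | nil =>
      simp only [List.nil_append, List.cons.injEq, true_and] at hw
      exact ⟨l, by omega, hw ▸ h2⟩
    | cons g u =>
      simp only [List.cons_append, List.cons.injEq] at hw
      obtain ⟨rfl, rfl⟩ := hw
      have := (D.rot hrot k [ib e] u h1).append h2
      exact ⟨_, le_rfl, by simpa using this⟩
  | @cell k f t y hR1 h =>
    simp only [List.cons.injEq] at hw
    obtain ⟨rfl, rfl⟩ := hw
    have h2 := D.rot hrot k (t ++ [ib e]) x (by simpa using h)
    exact bubble hrot (r := t ++ [ib e]) (hrot [ib e] t hR1) k _ h2 x rfl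

/-- area at most k -/
def AreaLe (R : List (α × Bool) → Prop) (k : ℕ) (g : FreeGroup α) : Prop :=
  ∃ w j, j ≤ k ∧ FreeGroup.mk w = g ∧ D R j w

theorem step_iff (hrot : ∀ a b, R (a ++ b) → R (b ++ a)) {k : ℕ} {w w' : List (α × Bool)}
    (h : FreeGroup.Red.Step w w') : (∃ j ≤ k, D R j w) ↔ (∃ j ≤ k, D R j w') := by
  cases h with
  | @not L1 L2 x b =>
    constructor
    · rintro ⟨j, hj, h⟩
      have := D.rot hrot j L1 _ h
      obtain ⟨i, hi, h2⟩ := D.delete (e := (x, b)) hrot (by simpa [ib] using this)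
      exact ⟨i, by omega, D.rot hrot i _ _ h2⟩
    · rintro ⟨j, hj, h⟩
      have := D.fold (e := (x, b)) D.nil (D.rot hrot j _ _ h)
      have := D.rot hrot _ ((x, b) :: (x, !b) :: L2) L1 (by simpa [ib] using this)
      exact ⟨_, by simpa using hj, this⟩

theorem area_iff (hrot : ∀ a b, R (a ++ b) → R (b ++ a)) {k : ℕ} {w : List (α × Bool)} :
    AreaLe R k (FreeGroup.mk w) ↔ ∃ j ≤ k, D R j w := by
  constructor
  · rintro ⟨w', j, hj, h1, h2⟩
    have h3 : Relation.EqvGen FreeGroup.Red.Step w' w := Quot.eqvGen_exact h1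
    have h4 : (∃ j ≤ k, D R j w') ↔ (∃ j ≤ k, D R j w) := by
      clear h2 h1
      induction h3 with
      | rel _ _ h => exact step_iff hrot h
      | refl _ => rfl
      | symm _ _ _ ih => exact ih.symm
      | trans _ _ _ _ _ ih1 ih2 => exact ih1.trans ih2
    exact h4.1 ⟨j, hj, h2⟩
  · rintro ⟨j, hj, h⟩
    exact ⟨w, j, hj, rfl, h⟩

theorem AreaLe.mono {k l : ℕ} {g : FreeGroup α} (h : AreaLe R k g) (hkl : k ≤ l) :
    AreaLe R l g := by
  obtain ⟨w, j, hj, h1, h2⟩ := h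
  exact ⟨w, j, by omega, h1, h2⟩

theorem AreaLe.one : AreaLe R 0 (1 : FreeGroup α) := ⟨[], 0, le_rfl, rfl, D.nil⟩

theorem AreaLe.mul {k l : ℕ} {g h : FreeGroup α} (hg : AreaLe R k g) (hh : AreaLe R l h) :
    AreaLe R (k + l) (g * h) := by
  obtain ⟨w, j, hj, h1, h2⟩ := hg
  obtain ⟨w', j', hj', h1', h2'⟩ := hh
  exact ⟨w ++ w', j + j', by omega, by rw [← FreeGroup.mul_mk, h1, h1'], h2.append h2'⟩

theorem AreaLe.conj {k : ℕ} {g : FreeGroup α} (hg : AreaLe R k g) (c : FreeGroup α) :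
    AreaLe R k (c * g * c⁻¹) := by
  obtain ⟨c, rfl⟩ := Quot.exists_rep c
  change AreaLe R k (FreeGroup.mk c * g * (FreeGroup.mk c)⁻¹)
  induction c generalizing g with
  | nil => rw [← FreeGroup.one_eq_mk]; simpa using hg
  | cons e c ih =>
    obtain ⟨w, j, hj, h1, h2⟩ := ih hg
    refine ⟨e :: (w ++ [ib e]), j, hj, ?_, by simpa using D.fold (e := e) h2 D.nil⟩
    have e1 : FreeGroup.mk (e :: c) = FreeGroup.mk [e] * FreeGroup.mk c := by
      simp [FreeGroup.mul_mk]
    have e2 : FreeGroup.mk (e :: (w ++ [ib e])) =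
        FreeGroup.mk [e] * FreeGroup.mk w * (FreeGroup.mk [e])⁻¹ := by
      simp [FreeGroup.mul_mk, FreeGroup.inv_mk, FreeGroup.invRev, ib]
    rw [e1, e2, h1]; group

theorem AreaLe.cyc {k : ℕ} {g h : FreeGroup α} (hg : AreaLe R k (g * h)) :
    AreaLe R k (h * g) := by
  have := hg.conj g⁻¹
  simpa using this

theorem D.inv (hrot : ∀ a b, R (a ++ b) → R (b ++ a))
    (hinv : ∀ a, R a → R (FreeGroup.invRev a)) {k : ℕ} {w : List (α × Bool)} (h : D R k w) :
    D R k (FreeGroup.invRev w) := by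
  induction h with
  | nil => exact D.nil
  | @fold k l f u v h1 h2 ih1 ih2 =>
    have := ih2.append (D.fold (e := f) ih1 D.nil)
    rw [add_comm]
    simpa [FreeGroup.invRev, ib] using this
  | @cell k f t y hR1 h ih =>
    have h1 : R (ib (ib f) :: FreeGroup.invRev t) := by
      have := hrot (FreeGroup.invRev t) [f] (by
        have := hinv _ hR1
        simpa [FreeGroup.invRev, ib] using this)
      simpa [ib_ib] using this
    have := last_cell hrot k (fun k' _ => D.rot hrot k') h1 k _ ih le_rfl (FreeGroup.invRev y)
      (by simp [FreeGroup.invRev])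
    simpa [FreeGroup.invRev, ib] using this

theorem AreaLe.inv (hrot : ∀ a b, R (a ++ b) → R (b ++ a))
    (hinv : ∀ a, R a → R (FreeGroup.invRev a)) {k : ℕ} {g : FreeGroup α} (hg : AreaLe R k g) :
    AreaLe R k g⁻¹ := by
  obtain ⟨w, j, hj, h1, h2⟩ := hg
  exact ⟨_, j, hj, by rw [← FreeGroup.inv_mk, h1], h2.inv hrot hinv⟩

theorem AreaLe.of_rel (hrot : ∀ a b, R (a ++ b) → R (b ++ a))
    (hinv : ∀ a, R a → R (FreeGroup.invRev a)) {r : List (α × Bool)}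
    (hr : R r) : AreaLe R 1 (FreeGroup.mk r) := by
  cases r with
  | nil => exact AreaLe.one.mono (by omega)
  | cons e r =>
    refine ⟨e :: r, 1, le_rfl, rfl, ?_⟩
    have h1 : R (ib e :: FreeGroup.invRev r) := by
      have := hrot (FreeGroup.invRev r) [ib e] (by
        have := hinv _ hr
        simpa [FreeGroup.invRev, ib] using this)
      simpa using this
    have h0 : AreaLe R 0 (FreeGroup.mk (FreeGroup.invRev r ++ r)) := by
      rw [← FreeGroup.mul_mk, ← FreeGroup.inv_mk, inv_mul_cancel]; exact AreaLe.one
    obtain ⟨j, hj, h2⟩ := (area_iff hrot).1 h0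
    obtain rfl : j = 0 := by omega
    exact D.cell h1 h2

theorem mk_cons (e : α × Bool) (w : List (α × Bool)) :
    FreeGroup.mk (e :: w) = FreeGroup.mk [e] * FreeGroup.mk w := by
  rw [FreeGroup.mul_mk]; rfl

theorem mk_ib (e : α × Bool) : FreeGroup.mk [ib e] = (FreeGroup.mk [e])⁻¹ := by
  rw [FreeGroup.inv_mk]; rfl

theorem mk_ib_cons (e : α × Bool) (w : List (α × Bool)) :
    FreeGroup.mk (ib e :: w) = (FreeGroup.mk [e])⁻¹ * FreeGroup.mk w := by
  rw [mk_cons, mk_ib]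

theorem mk_append (u w : List (α × Bool)) :
    FreeGroup.mk (u ++ w) = FreeGroup.mk u * FreeGroup.mk w := by
  rw [FreeGroup.mul_mk]

theorem D.value {G : Type*} [Group G] (φ : FreeGroup α →* G)
    (hφ : ∀ r, R r → φ (FreeGroup.mk r) = 1) {k : ℕ} {w : List (α × Bool)} (h : D R k w) :
    φ (FreeGroup.mk w) = 1 := by
  induction h with
  | nil => rw [← FreeGroup.one_eq_mk, map_one]
  | @fold k l f u v h1 h2 ih1 ih2 =>
    rw [mk_cons, mk_append, mk_ib_cons]; simp only [map_mul, ih1, ih2, map_inv]; group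
  | @cell k f t y hR1 h ih =>
    have h1 := hφ _ hR1
    rw [mk_ib_cons, map_mul, map_inv, inv_mul_eq_one] at h1
    rw [mk_cons, map_mul, h1, ← map_mul, ← mk_append, ih]

theorem AreaLe.value {G : Type*} [Group G] (φ : FreeGroup α →* G)
    (hφ : ∀ r, R r → φ (FreeGroup.mk r) = 1) {k : ℕ} {g : FreeGroup α} (h : AreaLe R k g) :
    φ g = 1 := by
  obtain ⟨w, j, hj, rfl, h2⟩ := h
  exact h2.value φ hφ
end
end VK

namespace VK

/-- SL2 -/
abbrev SL2 := Matrix.SpecialLinearGroup (Fin 2) ℝ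

/-- upper unipotent -/
def Upp (t : ℝ) : SL2 := ⟨!![1, t; 0, 1], by simp [Matrix.det_fin_two]⟩
/-- lower unipotent -/
def Low (t : ℝ) : SL2 := ⟨!![1, 0; -t, 1], by simp [Matrix.det_fin_two]⟩
/-- rotation -/
def Uro : SL2 := ⟨!![0, 1; -1, 0], by simp [Matrix.det_fin_two]⟩

theorem Upp_coe (t : ℝ) : (↑(Upp t) : Matrix (Fin 2) (Fin 2) ℝ) = !![1, t; 0, 1] := rfl
theorem Low_coe (t : ℝ) : (↑(Low t) : Matrix (Fin 2) (Fin 2) ℝ) = !![1, 0; -t, 1] := rfl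
theorem Uro_coe : (↑Uro : Matrix (Fin 2) (Fin 2) ℝ) = !![0, 1; -1, 0] := rfl

theorem Upp_mul (s t : ℝ) : Upp s * Upp t = Upp (s + t) := by
  ext i j; fin_cases i <;> fin_cases j <;> simp [Upp_coe, Matrix.mul_apply, add_comm]

theorem Low_mul (s t : ℝ) : Low s * Low t = Low (s + t) := by
  ext i j; fin_cases i <;> fin_cases j <;> simp [Low_coe, Matrix.mul_apply, add_comm]

theorem Upp_zero : Upp 0 = 1 := by
  ext i j; fin_cases i <;> fin_cases j <;> simp [Upp_coe]

theorem Low_zero : Low 0 = 1 := by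
  ext i j; fin_cases i <;> fin_cases j <;> simp [Low_coe]

theorem Upp_zpow (t : ℝ) (k : ℤ) : Upp t ^ k = Upp (k * t) := by
  induction k with
  | zero => simp [Upp_zero]
  | succ k ih => rw [zpow_add_one, ih, Upp_mul]; push_cast; ring_nf
  | pred k ih =>
    have : (Upp t)⁻¹ = Upp (-t) := by
      rw [inv_eq_iff_mul_eq_one, Upp_mul]; simp [Upp_zero]
    rw [zpow_sub_one, ih, this, Upp_mul]; push_cast; ring_nf

theorem Low_zpow (t : ℝ) (k : ℤ) : Low t ^ k = Low (k * t) := by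
  induction k with
  | zero => simp [Low_zero]
  | succ k ih => rw [zpow_add_one, ih, Low_mul]; push_cast; ring_nf
  | pred k ih =>
    have : (Low t)⁻¹ = Low (-t) := by
      rw [inv_eq_iff_mul_eq_one, Low_mul]; simp [Low_zero]
    rw [zpow_sub_one, ih, this, Low_mul]; push_cast; ring_nf

theorem no6 (mu : ℝ) (hmu : 3 < mu) (k l k' p q r : ℤ) (hk : k ≠ 0) (hl : l ≠ 0) (hk' : k' ≠ 0)
    (hp : p ≠ 0) (hr : r ≠ 0)
    (h1 : k * l = q * r) (h2 : k' * l = p * q) (h3 : (q : ℝ) = k + k' - k * k' * l * mu) : False := by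
  have a1 : |q| ≤ |k| * |l| := by
    rw [← abs_mul, h1, abs_mul]; nlinarith [abs_nonneg q, Int.one_le_abs hr]
  have a2 : |q| ≤ |k'| * |l| := by
    rw [← abs_mul, h2, abs_mul]; nlinarith [abs_nonneg q, Int.one_le_abs hp]
  have b1 := Int.one_le_abs hk
  have b2 := Int.one_le_abs hl
  have b3 := Int.one_le_abs hk'
  have key : |k| + |k'| + |q| ≤ 3 * (|k| * |k'| * |l|) := by
    have c1 : |k| ≤ |k| * |k'| * |l| := by
      calc |k| = |k| * 1 * 1 := by ring
        _ ≤ _ := by gcongr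
    have c2 : |k'| ≤ |k| * |k'| * |l| := by
      calc |k'| = 1 * |k'| * 1 := by ring
        _ ≤ _ := by gcongr
    have c3 : |q| ≤ |k| * |k'| * |l| := by
      calc |q| ≤ |k| * |l| := a1
        _ = |k| * 1 * |l| := by ring
        _ ≤ _ := by gcongr
    linarith
  have key2 : (|(k:ℝ)| + |(k':ℝ)| + |(q:ℝ)|) ≤ 3 * (|(k:ℝ)| * |(k':ℝ)| * |(l:ℝ)|) := by
    exact_mod_cast key
  have e : (k:ℝ) * k' * l * mu = k + k' - q := by linarith
  have e2 : |(k:ℝ)| * |(k':ℝ)| * |(l:ℝ)| * mu = |(k:ℝ) + k' - q| := by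
    rw [← e, abs_mul, abs_mul, abs_mul, abs_of_pos (by linarith : (0:ℝ) < mu)]
  have e3 : |(k:ℝ) + k' - q| ≤ |(k:ℝ)| + |(k':ℝ)| + |(q:ℝ)| := by
    calc |(k:ℝ) + k' - q| ≤ |(k:ℝ) + k'| + |(q:ℝ)| := abs_sub _ _
      _ ≤ _ := by gcongr; exact abs_add_le _ _
  have pos : 0 < |(k:ℝ)| * |(k':ℝ)| * |(l:ℝ)| := by positivity
  nlinarith

/-- alternating product -/
def altp {G : Type*} [Group G] (a b : G) : List ℤ → G
  | [] => 1
  | k :: ks => a ^ k * altp b a ks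

theorem altp_map {G H : Type*} [Group G] [Group H] (f : G →* H) (a b : G) (ks : List ℤ) :
    f (altp a b ks) = altp (f a) (f b) ks := by
  induction ks generalizing a b with
  | nil => simp [altp]
  | cons k ks ih => simp [altp, ih]

theorem altp_ne {t : ℝ} (ht : 3 < t * t) {a b : SL2} (ha : a = Upp t)
    (hb : b = Low t) {ks : List ℤ} (h0 : ∀ k ∈ ks, k ≠ 0) (hl : ks.length = 1 ∨ ks.length = 2
      ∨ ks.length = 4 ∨ ks.length = 6) : altp a b ks ≠ 1 := by
  have t0 : t ≠ 0 := by rintro rfl; norm_num at ht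
  subst ha hb
  intro h
  rcases hl with hl | hl | hl | hl
  · obtain ⟨k, rfl⟩ := List.length_eq_one_iff.1 hl
    simp only [altp, Upp_zpow, mul_one] at h
    have := congrArg (fun m : SL2 => (m : Matrix (Fin 2) (Fin 2) ℝ) 0 1) h
    simp [Upp_coe, t0] at this
    exact h0 k (by simp) this
  · obtain ⟨k, l, rfl⟩ := List.length_eq_two.1 hl
    simp only [altp, Upp_zpow, Low_zpow, mul_one] at h
    have := congrArg (fun m : SL2 => (m : Matrix (Fin 2) (Fin 2) ℝ) 0 1) h
    simp [Upp_coe, Low_coe, Matrix.mul_apply, t0] at this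
    exact h0 k (by simp) this
  · match ks, hl with
    | [k, l, p, q], _ =>
      simp only [altp, Upp_zpow, Low_zpow, mul_one] at h
      rw [← mul_assoc, mul_eq_one_iff_eq_inv, mul_inv_rev] at h
      have e1 : (Low (q * t))⁻¹ = Low (-q * t) := by
        rw [inv_eq_iff_mul_eq_one, Low_mul]; ring_nf; exact Low_zero
      have e2 : (Upp (p * t))⁻¹ = Upp (-p * t) := by
        rw [inv_eq_iff_mul_eq_one, Upp_mul]; ring_nf; exact Upp_zero
      rw [e1, e2] at h
      have := congrArg (fun m : SL2 => (m : Matrix (Fin 2) (Fin 2) ℝ) 0 0) h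
      simp [Upp_coe, Low_coe, Matrix.mul_apply, t0] at this
      rcases this with h | h
      · exact h0 k (by simp) h
      · exact h0 l (by simp) h
  · match ks, hl with
    | [k, l, k', r, q, p], _ =>
      simp only [altp, Upp_zpow, Low_zpow, mul_one] at h
      rw [← mul_assoc, ← mul_assoc, mul_eq_one_iff_eq_inv, mul_inv_rev, mul_inv_rev] at h
      have e0 : (Low (r * t))⁻¹ = Low (-r * t) := by
        rw [inv_eq_iff_mul_eq_one, Low_mul]; ring_nf; exact Low_zero
      have e1 : (Low (p * t))⁻¹ = Low (-p * t) := by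
        rw [inv_eq_iff_mul_eq_one, Low_mul]; ring_nf; exact Low_zero
      have e2 : (Upp (q * t))⁻¹ = Upp (-q * t) := by
        rw [inv_eq_iff_mul_eq_one, Upp_mul]; ring_nf; exact Upp_zero
      rw [e0, e1, e2] at h
      have h1 := congrArg (fun m : SL2 => (m : Matrix (Fin 2) (Fin 2) ℝ) 0 0) h
      have h2 := congrArg (fun m : SL2 => (m : Matrix (Fin 2) (Fin 2) ℝ) 1 1) h
      have h3 := congrArg (fun m : SL2 => (m : Matrix (Fin 2) (Fin 2) ℝ) 0 1) h
      simp [Upp_coe, Low_coe, Matrix.mul_apply] at h1 h2 h3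
      have tt : t * t ≠ 0 := mul_ne_zero t0 t0
      refine no6 (t * t) ht k l k' (-p) (-q) (-r) (h0 k (by simp)) (h0 l (by simp))
        (h0 k' (by simp)) (by simpa using h0 p (by simp)) (by simpa using h0 r (by simp)) ?_ ?_ ?_
      · have : (k * l : ℝ) * (t * t) = ((-q) * (-r) : ℝ) * (t * t) := by linarith
        have := mul_right_cancel₀ tt this
        exact_mod_cast this
      · have : (k' * l : ℝ) * (t * t) = ((-p) * (-q) : ℝ) * (t * t) := by linarith
        have := mul_right_cancel₀ tt this
        exact_mod_cast this
      · apply mul_right_cancel₀ t0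
        push_cast
        linarith

theorem braid_aux {G : Type*} [Group G] {σ : Type*} (φ : FreeGroup σ →* G) (U : G) :
    ∀ (m : ℕ) (i j : σ), U * φ (.of i) = φ (.of j) * U → U * φ (.of j) = φ (.of i) * U →
    U * φ (altWord i j m) = φ (altWord j i m) * U ∧
    φ (altWord i j m) * U ^ m = (φ (.of i) * U) ^ m := by
  intro m
  induction m with
  | zero => intro i j h1 h2; simp [altWord]
  | succ m ih =>
    intro i j h1 h2
    obtain ⟨a1, a2⟩ := ih i j h1 h2
    obtain ⟨b1, b2⟩ := ih j i h2 h1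
    constructor
    · simp only [altWord, map_mul]
      rw [← mul_assoc, h1, mul_assoc, b1, mul_assoc]
    · simp only [altWord, map_mul]
      rw [pow_succ' U, ← mul_assoc, mul_assoc _ _ U, ← a1, pow_succ' (φ (.of i) * U), ← a2]
      group

theorem rot_pow (θ : ℝ) (k : ℕ) : Real.sin θ • (!![-(2 * Real.cos θ), 1; -1, 0] ^ k :
    Matrix (Fin 2) (Fin 2) ℝ) = (-1 : ℝ) ^ k • !![Real.sin ((k + 1) * θ), - Real.sin (k * θ);
      Real.sin (k * θ), - Real.sin ((k - 1) * θ)] := by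
  induction k with
  | zero => ext i j; fin_cases i <;> fin_cases j <;> simp
  | succ k ih =>
    rw [pow_succ, ← smul_mul_assoc, ih]
    have s1 : Real.sin ((k + 1 + 1) * θ) = 2 * Real.cos θ * Real.sin ((k + 1) * θ) - Real.sin (k * θ) := by
      have e1 : ((k : ℝ) + 1 + 1) * θ = (k + 1) * θ + θ := by ring
      have e2 : (k : ℝ) * θ = (k + 1) * θ - θ := by ring
      rw [e1, e2, Real.sin_add, Real.sin_sub]; ring
    have s2 : Real.sin ((k + 1) * θ) = 2 * Real.cos θ * Real.sin (k * θ) - Real.sin ((k - 1) * θ) := by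
      have e1 : ((k : ℝ) + 1) * θ = k * θ + θ := by ring
      have e2 : ((k : ℝ) - 1) * θ = k * θ - θ := by ring
      rw [e1, e2, Real.sin_add, Real.sin_sub]; ring
    ext i j; fin_cases i <;> fin_cases j <;>
      simp [Matrix.mul_apply, pow_succ, s1] <;> rw [s2] <;> ring

theorem braid_cos (m : ℕ) (hm : 7 ≤ m) {σ : Type*} (φ : FreeGroup σ →* SL2)
    (i j : σ) (hi : φ (.of i) = Upp (2 * Real.cos (Real.pi / m)))
    (hj : φ (.of j) = Low (2 * Real.cos (Real.pi / m))) :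
    φ (altWord i j m) = φ (altWord j i m) := by
  have m0 : (0 : ℝ) < m := by exact_mod_cast (by omega : 0 < m)
  set θ := Real.pi / m with hθ
  have hmθ : m * θ = Real.pi := by rw [hθ]; field_simp
  have hs : Real.sin θ ≠ 0 := by
    apply ne_of_gt; apply Real.sin_pos_of_pos_of_lt_pi
    · positivity
    · rw [hθ]; apply div_lt_self Real.pi_pos; exact_mod_cast (by omega : 1 < m)
  have h1 : Uro * φ (.of i) = φ (.of j) * Uro := by
    rw [hi, hj]; ext a b; fin_cases a <;> fin_cases b <;> simp [Uro_coe, Upp_coe, Low_coe, Matrix.mul_apply]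
  have h2 : Uro * φ (.of j) = φ (.of i) * Uro := by
    rw [hi, hj]; ext a b; fin_cases a <;> fin_cases b <;> simp [Uro_coe, Upp_coe, Low_coe, Matrix.mul_apply]
  obtain ⟨a1, a2⟩ := braid_aux φ Uro m i j h1 h2
  have hC : ((φ (.of i) * Uro : SL2) : Matrix (Fin 2) (Fin 2) ℝ) =
      !![-(2 * Real.cos θ), 1; -1, 0] := by
    rw [hi]; ext a b; fin_cases a <;> fin_cases b <;> simp [Uro_coe, Upp_coe, Matrix.mul_apply]
  have hcomm : Commute ((φ (.of i) * Uro) ^ m) Uro := by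
    have e := rot_pow θ m
    have e1 : ((m : ℝ) + 1) * θ = θ + Real.pi := by rw [add_mul, hmθ]; ring
    have e2 : ((m : ℝ) - 1) * θ = Real.pi - θ := by rw [sub_mul, hmθ]; ring
    rw [hmθ, e1, e2, Real.sin_add_pi, Real.sin_pi_sub, Real.sin_pi, neg_zero] at e
    have e3 : (!![-(2 * Real.cos θ), 1; -1, 0] ^ m : Matrix (Fin 2) (Fin 2) ℝ) =
        (-(-1 : ℝ) ^ m) • (1 : Matrix (Fin 2) (Fin 2) ℝ) := by
      have : Real.sin θ • (!![-(2 * Real.cos θ), 1; -1, 0] ^ m : Matrix (Fin 2) (Fin 2) ℝ) =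
        Real.sin θ • ((-(-1 : ℝ) ^ m) • (1 : Matrix (Fin 2) (Fin 2) ℝ)) := by
        rw [e]; ext a b; fin_cases a <;> fin_cases b <;> simp [mul_comm]
      exact smul_right_injective _ hs this
    change _ * _ = _ * _
    ext a b
    rw [Matrix.SpecialLinearGroup.coe_mul, Matrix.SpecialLinearGroup.coe_mul,
      Matrix.SpecialLinearGroup.coe_pow, hC, e3]; simp
  rw [← a2] at hcomm
  have h3 : Commute (φ (altWord i j m)) Uro := by
    have : φ (altWord i j m) = φ (altWord i j m) * Uro ^ m * (Uro ^ m)⁻¹ := by group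
    rw [this]
    exact hcomm.mul_left ((Commute.refl Uro).pow_left m).inv_left
  have h4 : φ (altWord i j m) * Uro = φ (altWord j i m) * Uro := by rw [← a1, h3.eq]
  exact mul_right_cancel h4

theorem cos_big (m : ℕ) (hm : 7 ≤ m) :
    3 < (2 * Real.cos (Real.pi / m)) * (2 * Real.cos (Real.pi / m)) := by
  have h : Real.cos (Real.pi / 6) < Real.cos (Real.pi / m) := by
    apply Real.cos_lt_cos_of_nonneg_of_le_pi (by positivity)
    · have := Real.pi_pos; linarith
    · apply div_lt_div_of_pos_left Real.pi_pos (by norm_num)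
      exact_mod_cast (by omega : 6 < m)
  rw [Real.cos_pi_div_six] at h
  have : √3 * √3 = 3 := Real.mul_self_sqrt (by norm_num)
  nlinarith [Real.sqrt_nonneg 3]

end VK

namespace VK

section chg
set_option linter.unusedSectionVars false
variable {α : Type} [DecidableEq α]

/-- number of label changes -/
def chg : List (α × Bool) → ℤ
  | a :: b :: l => (if a.1 = b.1 then 0 else 1) + chg (b :: l)
  | _ => 0

/-- cyclic number of label changes -/
def cyc (w : List (α × Bool)) : ℤ := chg (w ++ w.head?.toList)

theorem chg_nonneg (w : List (α × Bool)) : 0 ≤ chg w := by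
  induction w with
  | nil => simp [chg]
  | cons a w ih =>
    cases w with
    | nil => simp [chg]
    | cons b w => simp only [chg]; split_ifs <;> omega

theorem chg_split (u v : List (α × Bool)) (a : α × Bool) :
    chg (u ++ a :: v) = chg (u ++ [a]) + chg (a :: v) := by
  induction u with
  | nil => simp [chg]
  | cons b u ih =>
    cases u with
    | nil => simp [chg]
    | cons c u => simp only [List.cons_append, chg] at *; omega

theorem cyc_rot (u v : List (α × Bool)) : cyc (u ++ v) = cyc (v ++ u) := by
  cases u with
  | nil => simp
  | cons a u =>
    cases v with
    | nil => simp
    | cons b v =>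
      have h1 := chg_split (a :: u) (v ++ [a]) b
      have h2 := chg_split (b :: v) (u ++ [b]) a
      simp only [cyc, List.cons_append, List.head?_cons, Option.toList_some, List.append_assoc] at *
      omega

theorem chg_parity {i j : α} (hij : i ≠ j) : ∀ (s : List (α × Bool)) (e f : α × Bool),
    (∀ l ∈ e :: s ++ [f], l.1 = i ∨ l.1 = j) → (Even (chg (e :: s ++ [f])) ↔ e.1 = f.1) := by
  intro s
  induction s with
  | nil =>
    intro e f h
    simp only [List.cons_append, List.nil_append, chg]
    split_ifs with h1 <;> simp [h1]
  | cons a s ih =>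
    intro e f h
    have h1 := ih a f (fun l hl => h l (by simp at *; tauto))
    have he := h e (by simp)
    have ha := h a (by simp)
    have hf := h f (by simp)
    simp only [List.cons_append, chg] at *
    split_ifs with h2
    · simp only [zero_add, h1, h2]
    · rw [Int.even_add, h1]
      simp only [Int.not_even_one, false_iff]
      clear h h1 ih
      grind

theorem mk_single (e : α × Bool) :
    FreeGroup.mk [e] = FreeGroup.of e.1 ^ (if e.2 then (1 : ℤ) else -1) := by
  rcases e with ⟨a, b⟩
  cases b
  · rfl
  · simp; rfl

theorem syll : ∀ (s : List (α × Bool)) (e : α × Bool) (j : α), e.1 ≠ j →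
    (∀ l ∈ e :: s, l.1 = e.1 ∨ l.1 = j) → FreeGroup.IsReduced (e :: s) →
    ∃ (k : ℤ) (ks : List ℤ), 0 < (if e.2 then (1 : ℤ) else -1) * k ∧ (∀ x ∈ ks, x ≠ 0) ∧
      (ks.length : ℤ) = chg (e :: s) ∧
      FreeGroup.mk (e :: s) = altp (.of e.1) (.of j) (k :: ks) := by
  intro s
  induction s with
  | nil =>
    intro e j hj _ _
    refine ⟨(if e.2 then (1 : ℤ) else -1), [], ?_, by simp, by simp [chg], ?_⟩
    · split_ifs <;> norm_num
    · rw [mk_single]; simp [altp]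
  | cons a s ih =>
    intro e j hj hl hr
    have hr' : FreeGroup.IsReduced (a :: s) := (List.isChain_cons_cons.1 hr).2
    have hea := (List.isChain_cons_cons.1 hr).1
    by_cases h : e.1 = a.1
    · obtain ⟨k, ks, h1, h2, h3, h4⟩ := ih a j (h ▸ hj)
        (fun l hl' => by rw [← h]; exact hl l (by simp at *; tauto)) hr'
      have h2' := hea h
      refine ⟨(if e.2 then (1 : ℤ) else -1) + k, ks, ?_, h2, ?_, ?_⟩
      · rw [h2']; split_ifs at * <;> linarith
      · simp [chg, h, h3]
      · rw [mk_cons, h4, mk_single, h]; simp only [altp]; rw [zpow_add, mul_assoc]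
    · have haj : a.1 = j := by
        rcases hl a (by simp) with h' | h'
        · exact absurd h'.symm h
        · exact h'
      obtain ⟨k, ks, h1, h2, h3, h4⟩ := ih a e.1 (Ne.symm h)
        (fun l hl' => by rw [haj]; exact (hl l (by simp at *; tauto)).symm) hr'
      refine ⟨(if e.2 then (1 : ℤ) else -1), k :: ks, ?_, ?_, ?_, ?_⟩
      · split_ifs <;> norm_num
      · intro x hx
        rcases List.mem_cons.1 hx with rfl | hx
        · rintro rfl; simp at h1
        · exact h2 x hx
      · simp [chg, h, h3, add_comm]
      · rw [mk_cons, h4, mk_single, haj]; rfl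

theorem exists_change : ∀ (w : List (α × Bool)), 0 < chg w →
    ∃ u a b v, w = u ++ a :: b :: v ∧ a.1 ≠ b.1 := by
  intro w
  induction w with
  | nil => intro h; simp [chg] at h
  | cons a w ih =>
    intro h
    cases w with
    | nil => simp [chg] at h
    | cons b w =>
      by_cases hab : a.1 = b.1
      · simp only [chg, hab, if_true, zero_add] at h
        obtain ⟨u, c, d, v, h1, h2⟩ := ih h
        exact ⟨a :: u, c, d, v, by rw [h1]; rfl, h2⟩
      · exact ⟨[], a, b, w, rfl, hab⟩

theorem cycred_rot (u v : List (α × Bool)) (h : FreeGroup.IsCyclicallyReduced (u ++ v)) :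
    FreeGroup.IsCyclicallyReduced (v ++ u) := by
  cases u with
  | nil => simpa using h
  | cons a u =>
    cases v with
    | nil => simpa using h
    | cons b v =>
      unfold FreeGroup.IsCyclicallyReduced FreeGroup.IsReduced at *
      rw [List.isChain_append] at *
      obtain ⟨⟨h1, h2, h3⟩, h4⟩ := h
      refine ⟨⟨h2, h1, ?_⟩, ?_⟩
      · intro x hx y hy
        apply h4
        · rw [List.getLast?_append]; simp [List.getLast?_cons] at *; exact hx
        · simpa using hy
      · intro x hx y hy
        apply h3
        · rw [List.getLast?_append] at hx; simp [List.getLast?_cons] at *; exact hx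
        · simpa using hy

theorem red_inv (u : List (α × Bool)) (h : FreeGroup.IsReduced u) :
    FreeGroup.IsReduced (FreeGroup.invRev u) := by
  unfold FreeGroup.IsReduced FreeGroup.invRev at *
  rw [List.isChain_reverse, List.isChain_map]
  refine h.imp ?_
  intro a b hab h1
  simp at *
  exact (hab h1.symm).symm

theorem cycred_inv (u : List (α × Bool)) (h : FreeGroup.IsCyclicallyReduced u) :
    FreeGroup.IsCyclicallyReduced (FreeGroup.invRev u) := by
  refine ⟨red_inv u h.1, ?_⟩
  intro a ha b hb
  simp only [FreeGroup.invRev, List.getLast?_reverse, List.head?_reverse, List.head?_map,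
    List.getLast?_map, Option.mem_def, Option.map_eq_some_iff] at ha hb
  obtain ⟨a', ha', rfl⟩ := ha
  obtain ⟨b', hb', rfl⟩ := hb
  intro hab
  have := h.2 b' hb' a' ha' hab.symm
  simp [this]

end chg

section artin
variable (n : ℕ) (M : Fin n → Fin n → ℕ∞)

/-- normal closure of the relators in q -/
def Nq (q : Finset (Fin n)) : Subgroup (FreeGroup (Fin n)) :=
  Subgroup.normalClosure {r | ∃ i ∈ q, ∃ j ∈ q, i ≠ j ∧ ∃ m : ℕ, M i j = (m : ℕ∞) ∧
      r = altWord i j m * (altWord j i m)⁻¹}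

instance (q : Finset (Fin n)) : (Nq n M q).Normal := Subgroup.normalClosure_normal

/-- relators -/
def RR (w : List (Fin n × Bool)) : Prop :=
  ∃ q : Finset (Fin n), q.card = 2 ∧ (∀ l ∈ w, l.1 ∈ q) ∧ FreeGroup.mk w ∈ Nq n M q ∧ w ≠ [] ∧
    FreeGroup.IsCyclicallyReduced w

variable {n M}

theorem RR_rot (a b) (h : RR n M (a ++ b)) : RR n M (b ++ a) := by
  obtain ⟨q, h1, h2, h3, h4, h5⟩ := h
  refine ⟨q, h1, fun l hl => h2 l (by simp at *; tauto), ?_, ?_, cycred_rot _ _ h5⟩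
  · rw [← FreeGroup.mul_mk] at *
    exact (inferInstance : (Nq n M q).Normal).mem_comm h3
  · simp at *; tauto

theorem RR_inv (a) (h : RR n M a) : RR n M (FreeGroup.invRev a) := by
  obtain ⟨q, h1, h2, h3, h4, h5⟩ := h
  refine ⟨q, h1, fun l hl => ?_, ?_, ?_, cycred_inv _ h5⟩
  · simp only [FreeGroup.invRev, List.mem_reverse, List.mem_map] at hl
    obtain ⟨l', hl', rfl⟩ := hl
    exact h2 l' hl'
  · rw [← FreeGroup.inv_mk]; exact inv_mem h3
  · simpa [FreeGroup.invRev] using h4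

theorem exists_rep (hsym : ∀ i j, M i j = M j i) (hM : ∀ i j, i ≠ j → 7 ≤ M i j)
    {i j : Fin n} (hij : i ≠ j) : ∃ (φ : FreeGroup (Fin n) →* SL2) (t : ℝ), 3 < t * t ∧
      φ (.of i) = Upp t ∧ φ (.of j) = Low t ∧ ∀ g ∈ Nq n M {i, j}, φ g = 1 := by
  obtain ⟨t, ht, htm⟩ : ∃ t : ℝ, 3 < t * t ∧ ∀ m : ℕ, M i j = m → 7 ≤ m ∧ t = 2 * Real.cos (Real.pi / m) := by
    by_cases h : M i j = ⊤
    · refine ⟨2, by norm_num, fun m hm => ?_⟩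
      rw [h] at hm; exact absurd hm (ENat.top_ne_natCast m)
    · obtain ⟨m, hm⟩ := ENat.ne_top_iff_exists.1 h
      have h7 : 7 ≤ m := by
        have := hM i j hij
        rw [← hm] at this; exact_mod_cast this
      refine ⟨_, cos_big m h7, fun m' hm' => ?_⟩
      rw [← hm] at hm'
      have : m = m' := by exact_mod_cast hm'
      subst this; exact ⟨h7, rfl⟩
  let φ : FreeGroup (Fin n) →* SL2 := FreeGroup.lift
    (fun x => if x = i then Upp t else if x = j then Low t else 1)
  have hi : φ (.of i) = Upp t := by simp [φ]
  have hj : φ (.of j) = Low t := by simp [φ, hij.symm]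
  refine ⟨φ, t, ht, hi, hj, ?_⟩
  have : Nq n M {i, j} ≤ φ.ker := by
    apply Subgroup.normalClosure_le_normal
    rintro r ⟨a, ha, b, hb, hab, m, hm, rfl⟩
    have hbr : M i j = m → φ (altWord i j m) = φ (altWord j i m) := by
      intro h
      obtain ⟨h7, rfl⟩ := htm m h
      exact braid_cos m h7 φ i j hi hj
    simp only [Finset.mem_insert, Finset.mem_singleton] at ha hb
    simp only [SetLike.mem_coe, MonoidHom.mem_ker, map_mul, map_inv, mul_inv_eq_one]
    rcases ha with rfl | rfl <;> rcases hb with rfl | rfl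
    · exact absurd rfl hab
    · exact hbr hm
    · exact (hbr (by rw [← hm, hsym])).symm
    · exact absurd rfl hab
  exact fun g hg => this hg

theorem RR_cyc (hsym : ∀ i j, M i j = M j i) (hM : ∀ i j, i ≠ j → 7 ≤ M i j)
    {w : List (Fin n × Bool)} (hw : RR n M w) : 8 ≤ cyc w := by
  have main : ∀ (e : Fin n × Bool) (s : List (Fin n × Bool)), RR n M (e :: s) →
      chg (e :: s) ≠ 0 ∧ chg (e :: s) ≠ 1 ∧ chg (e :: s) ≠ 3 ∧ chg (e :: s) ≠ 5 := by
    rintro e s ⟨q, h1, h2, h3, h4, h5⟩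
    obtain ⟨x, y, hxy, rfl⟩ := Finset.card_eq_two.1 h1
    obtain ⟨j, hj, hq⟩ : ∃ j, e.1 ≠ j ∧ ({x, y} : Finset (Fin n)) = {e.1, j} := by
      have := h2 e (by simp)
      simp only [Finset.mem_insert, Finset.mem_singleton] at this
      rcases this with h | h
      · exact ⟨y, by rw [h]; exact hxy, by rw [h]⟩
      · exact ⟨x, by rw [h]; exact hxy.symm, by rw [h]; exact Finset.pair_comm x y⟩
    rw [hq] at h2 h3
    obtain ⟨φ, t, ht, hi, hjj, hN⟩ := exists_rep hsym hM hj
    obtain ⟨k, ks, a1, a2, a3, a4⟩ := syll s e j hj (by simpa using h2) h5.1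
    have := hN _ h3
    rw [a4, altp_map] at this
    have hne := altp_ne (ks := k :: ks) ht hi hjj (by
      intro z hz
      rcases List.mem_cons.1 hz with rfl | hz
      · rintro rfl; simp at a1
      · exact a2 z hz)
    refine ⟨?_, ?_, ?_, ?_⟩ <;> intro hc <;> refine hne ?_ this <;> simp only [List.length_cons] <;> omega
  have hpar : Even (cyc w) := by
    obtain ⟨q, h1, h2, h3, h4, h5⟩ := hw
    obtain ⟨x, y, hxy, rfl⟩ := Finset.card_eq_two.1 h1
    cases w with
    | nil => exact absurd rfl h4
    | cons e s =>
      simp only [cyc, List.head?_cons, Option.toList_some]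
      rw [chg_parity hxy]
      intro l hl
      have : l ∈ e :: s := by simp at *; tauto
      simpa using h2 l this
  have h0 : 0 ≤ cyc w := chg_nonneg _
  by_cases hc : cyc w = 0
  · exfalso
    cases w with
    | nil => exact hw.choose_spec.2.2.2.1 rfl
    | cons e s =>
      have h1 := (main e s hw).1
      simp only [cyc, List.head?_cons, Option.toList_some] at hc
      have h2 := chg_nonneg (e :: s)
      rcases List.eq_nil_or_concat (e :: s) with h3 | ⟨u, a, h3⟩
      · simp at h3
      · rw [List.concat_eq_append] at h3
        rw [h3, List.append_assoc] at hc
        have h4 := chg_split u [e] a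
        simp only [List.cons_append, List.nil_append] at hc
        have h5 := chg_nonneg [a, e]
        rw [← h3] at h4
        omega
  · -- rotate
    have key : ∃ b t a, RR n M (b :: t ++ [a]) ∧ a.1 ≠ b.1 ∧ cyc w = cyc (b :: t ++ [a]) := by
      cases w with
      | nil => exact absurd rfl (hw.choose_spec.2.2.2.1)
      | cons e s =>
        obtain ⟨u, a, b, v, h1, h2⟩ := exists_change (e :: s ++ [e]) (by
          have : cyc (e :: s) = chg (e :: s ++ [e]) := rfl
          omega)
        rcases List.eq_nil_or_concat v with rfl | ⟨v', c, rfl⟩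
        · have h3 : e :: s ++ [e] = (u ++ [a]) ++ [b] := by simpa using h1
          obtain ⟨h4, h5⟩ := List.append_inj' h3 rfl
          have hb : e = b := by simpa using h5
          subst hb
          cases u with
          | nil =>
            simp only [List.nil_append, List.cons.injEq] at h4
            exact absurd (by rw [h4.1]) h2
          | cons d u =>
            simp only [List.cons_append, List.cons.injEq] at h4
            obtain ⟨rfl, rfl⟩ := h4
            exact ⟨e, u, a, by simpa using hw, h2, rfl⟩
        · rw [List.concat_eq_append] at h1
          have h3 : e :: s ++ [e] = (u ++ a :: b :: v') ++ [c] := by simpa using h1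
          obtain ⟨h4, h5⟩ := List.append_inj' h3 rfl
          have h6 : e :: s = (u ++ [a]) ++ (b :: v') := by simpa using h4
          rw [h6] at hw ⊢
          refine ⟨b, v' ++ u, a, ?_, h2, ?_⟩
          · simpa using RR_rot _ _ hw
          · rw [cyc_rot]; simp
    obtain ⟨b, t, a, hR, hab, hcy⟩ := key
    have h1 := main b (t ++ [a]) (by simpa using hR)
    have h2 : cyc (b :: t ++ [a]) = chg (b :: (t ++ [a])) + 1 := by
      have := chg_split (b :: t) [b] a
      simp only [cyc, List.cons_append, List.head?_cons, Option.toList_some, List.append_assoc,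
        List.nil_append] at *
      rw [this]; simp [chg, hab]
    obtain ⟨r, hr⟩ := hpar
    omega

end artin
end VK

namespace VK
section artin
variable {n : ℕ} {M : Fin n → Fin n → ℕ∞}

variable (n M) in
/-- elements of the free group on q which are relators -/
def Zq (q : Finset (Fin n)) : Subgroup (FreeGroup (Fin n)) :=
  Subgroup.closure (FreeGroup.of '' (q : Set (Fin n))) ⊓ Nq n M q

variable (n M) in
/-- area -/
def Ar (k : ℕ) (g : FreeGroup (Fin n)) : Prop := AreaLe (RR n M) k g

theorem mem_closure_iff {q : Finset (Fin n)} {g : FreeGroup (Fin n)} :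
    g ∈ Subgroup.closure (FreeGroup.of '' (q : Set (Fin n))) ↔
      ∃ w : List (Fin n × Bool), (∀ l ∈ w, l.1 ∈ q) ∧ FreeGroup.mk w = g := by
  constructor
  · intro h
    induction h using Subgroup.closure_induction with
    | mem x hx =>
      obtain ⟨i, hi, rfl⟩ := hx
      exact ⟨[(i, true)], by simpa using hi, rfl⟩
    | one => exact ⟨[], by simp, rfl⟩
    | mul x y _ _ hx hy =>
      obtain ⟨u, hu, rfl⟩ := hx
      obtain ⟨v, hv, rfl⟩ := hy
      refine ⟨u ++ v, ?_, by rw [FreeGroup.mul_mk]⟩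
      intro l hl
      rcases List.mem_append.1 hl with hl | hl
      · exact hu l hl
      · exact hv l hl
    | inv x _ hx =>
      obtain ⟨u, hu, rfl⟩ := hx
      refine ⟨FreeGroup.invRev u, ?_, by rw [FreeGroup.inv_mk]⟩
      intro l hl
      simp only [FreeGroup.invRev, List.mem_reverse, List.mem_map] at hl
      obtain ⟨l', hl', rfl⟩ := hl
      exact hu l' hl'
  · rintro ⟨w, hw, rfl⟩
    induction w with
    | nil => exact one_mem _
    | cons e w ih =>
      rw [mk_cons, mk_single]
      have h1 : FreeGroup.of e.1 ∈ Subgroup.closure (FreeGroup.of '' (q : Set (Fin n))) :=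
        Subgroup.subset_closure ⟨e.1, hw e (by simp), rfl⟩
      exact mul_mem (zpow_mem h1 _) (ih fun l hl => hw l (by simp [hl]))

theorem reduce_mem {w : List (Fin n × Bool)} {q : Finset (Fin n)} (h : ∀ l ∈ w, l.1 ∈ q) :
    ∀ l ∈ FreeGroup.reduce w, l.1 ∈ q := fun l hl =>
  h l ((FreeGroup.Red.sublist FreeGroup.reduce.red).mem hl)

theorem Zq_area {q : Finset (Fin n)} (hq : q.card = 2) {g : FreeGroup (Fin n)}
    (hg : g ∈ Zq n M q) : Ar n M 1 g := by
  obtain ⟨h1, h2⟩ := hg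
  obtain ⟨w, hw, rfl⟩ := mem_closure_iff.1 h1
  rw [← FreeGroup.reduce.self] at h2 ⊢
  set L := FreeGroup.reduce w with hL
  have hLq := reduce_mem hw
  rw [← hL] at hLq
  have hred : FreeGroup.IsReduced L := by
    have := FreeGroup.isReduced_toWord (x := FreeGroup.mk w)
    rwa [FreeGroup.toWord_mk] at this
  have e := FreeGroup.reduceCyclically.conj_conjugator_reduceCyclically L
  have e2 : FreeGroup.mk L = FreeGroup.mk (FreeGroup.reduceCyclically.conjugator L) *
      FreeGroup.mk (FreeGroup.reduceCyclically L) *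
      (FreeGroup.mk (FreeGroup.reduceCyclically.conjugator L))⁻¹ := by
    rw [FreeGroup.inv_mk, FreeGroup.mul_mk, FreeGroup.mul_mk, e]
  by_cases hnil : FreeGroup.reduceCyclically L = []
  · rw [e2, hnil, ← FreeGroup.one_eq_mk, mul_one, mul_inv_cancel]; exact AreaLe.one.mono (by omega)
  · rw [e2] at h2 ⊢
    apply AreaLe.conj
    apply AreaLe.of_rel RR_rot RR_inv
    refine ⟨q, hq, ?_, ?_, hnil, FreeGroup.reduceCyclically.isCyclicallyReduced hred⟩
    · intro l hl
      apply hLq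
      rw [← e]; simp [hl]
    · have := (inferInstance : (Nq n M q).Normal).conj_mem _ h2
        (FreeGroup.mk (FreeGroup.reduceCyclically.conjugator L))⁻¹
      simpa [mul_assoc, -FreeGroup.mul_mk, -FreeGroup.inv_mk] using this

theorem Nq_le_ker (q : Finset (Fin n)) : Nq n M q ≤ (artinMk n M).ker := by
  apply Subgroup.normalClosure_le_normal
  rintro r ⟨i, _, j, _, hij, m, hm, rfl⟩
  exact (PresentedGroup.one_of_mem (rels := artinRels n M) ⟨i, j, hij, m, hm, rfl⟩)

theorem RR_value (r) (h : RR n M r) : artinMk n M (FreeGroup.mk r) = 1 := by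
  obtain ⟨q, h1, h2, h3, _⟩ := h
  exact Nq_le_ker q h3

theorem Ar.value {k : ℕ} {g : FreeGroup (Fin n)} (h : Ar n M k g) : artinMk n M g = 1 :=
  AreaLe.value (artinMk n M) RR_value h

theorem altWord_mem (i j : Fin n) (m : ℕ) (q : Finset (Fin n)) (hi : i ∈ q) (hj : j ∈ q) :
    altWord i j m ∈ Subgroup.closure (FreeGroup.of '' (q : Set (Fin n))) := by
  induction m generalizing i j with
  | zero => exact one_mem _
  | succ m ih => exact mul_mem (Subgroup.subset_closure ⟨i, hi, rfl⟩) (ih j i hj hi)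

theorem ker_area {g : FreeGroup (Fin n)} (h : artinMk n M g = 1) : ∃ k, Ar n M k g := by
  let S : Subgroup (FreeGroup (Fin n)) :=
    { carrier := {g | ∃ k, Ar n M k g}
      mul_mem' := by
        rintro a b ⟨k, hk⟩ ⟨l, hl⟩; exact ⟨k + l, AreaLe.mul hk hl⟩
      one_mem' := ⟨0, AreaLe.one⟩
      inv_mem' := by rintro a ⟨k, hk⟩; exact ⟨k, AreaLe.inv RR_rot RR_inv hk⟩ }
  have : S.Normal := ⟨by rintro a ⟨k, hk⟩ c; exact ⟨k, AreaLe.conj hk c⟩⟩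
  have h1 : g ∈ Subgroup.normalClosure (artinRels n M) := (QuotientGroup.eq_one_iff g).1 h
  have h2 : Subgroup.normalClosure (artinRels n M) ≤ S := by
    apply Subgroup.normalClosure_le_normal
    rintro r ⟨i, j, hij, m, hm, rfl⟩
    refine ⟨1, Zq_area (q := {i, j}) (Finset.card_pair hij) ⟨?_, ?_⟩⟩
    · exact Subgroup.mul_mem _ (altWord_mem _ _ _ _ (by simp) (by simp))
        (Subgroup.inv_mem _ (altWord_mem _ _ _ _ (by simp) (by simp)))
    · exact Subgroup.subset_normalClosure ⟨i, by simp, j, by simp, hij, m, hm, rfl⟩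
  exact h2 h1

end artin
end VK

namespace VK

/-- decorated letters -/
structure Ed (n : ℕ) where
  /-- letter -/
  l : Fin n × Bool
  /-- type -/
  ty : Finset (Fin n)
  /-- outer angle -/
  o : ℤ

section
variable {n : ℕ} {M : Fin n → Fin n → ℕ∞}

/-- letter as free group element -/
def lt (l : Fin n × Bool) : FreeGroup (Fin n) := FreeGroup.mk [l]
/-- word as free group element -/
def fw (w : List (Fin n × Bool)) : FreeGroup (Fin n) := FreeGroup.mk w
/-- decorated word as free group element -/
def fg (xs : List (Ed n)) : FreeGroup (Fin n) := fw (xs.map Ed.l)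

theorem fw_nil : fw ([] : List (Fin n × Bool)) = 1 := rfl
theorem fw_cons (e : Fin n × Bool) (w) : fw (e :: w) = lt e * fw w := mk_cons e w
theorem fw_append (u w : List (Fin n × Bool)) : fw (u ++ w) = fw u * fw w := mk_append u w
theorem lt_ib (e : Fin n × Bool) : lt (ib e) = (lt e)⁻¹ := mk_ib e
theorem fg_nil : fg ([] : List (Ed n)) = 1 := rfl
theorem fg_cons (e : Ed n) (w) : fg (e :: w) = lt e.l * fg w := by simp [fg, fw_cons]
theorem fg_append (u w : List (Ed n)) : fg (u ++ w) = fg u * fg w := by simp [fg, fw_append]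

/-- angle between labels -/
def ang (a b : Fin n) : ℤ := if a = b then 3 else 2

theorem ang_ge (a b : Fin n) : 2 ≤ ang a b := by unfold ang; split_ifs <;> norm_num
theorem ang_le (a b : Fin n) : ang a b ≤ 3 := by unfold ang; split_ifs <;> norm_num
theorem ang_self (a : Fin n) : ang a a = 3 := by simp [ang]
theorem ang_comm (a b : Fin n) : ang a b = ang b a := by simp [ang, eq_comm]

/-- admissible vertex -/
def Vok (L : Ed n) (o : ℤ) (R : Ed n) : Prop :=
  (L.ty = R.ty ∧ ang L.l.1 R.l.1 ≤ o ∧ R.l ≠ ib L.l) ∨ 6 ≤ o ∨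
    ∃ g, g ∈ L.ty ∧ g ∈ R.ty ∧ ang L.l.1 g + ang g R.l.1 ≤ o

theorem Vok.two {L R : Ed n} {o : ℤ} (h : Vok L o R) : 2 ≤ o := by
  rcases h with ⟨_, h, _⟩ | h | ⟨g, _, _, h⟩
  · have := ang_ge L.l.1 R.l.1; omega
  · omega
  · have := ang_ge L.l.1 g; have := ang_ge g R.l.1; omega

theorem Vok.merge {L R e e' : Ed n} {o o' : ℤ} (h : Vok L o e) (h' : Vok e' o' R)
    (hl : e.l.1 = e'.l.1) (h1 : e.l.1 ∈ e.ty) (h2 : e'.l.1 ∈ e'.ty) : Vok L (o + o') R := by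
  have t := h.two
  have t' := h'.two
  rcases h with ⟨a1, a2, _⟩ | h | ⟨g, _, _, h⟩
  · rcases h' with ⟨b1, b2, _⟩ | h' | ⟨g, _, _, h'⟩
    · right; right
      refine ⟨e.l.1, by rw [a1]; exact h1, by rw [← b1, hl]; exact h2, ?_⟩
      rw [← hl] at b2
      omega
    · right; left; omega
    · have := ang_ge e'.l.1 g; have := ang_ge g R.l.1; right; left; omega
  · right; left; omega
  · have := ang_ge L.l.1 g; have := ang_ge g e.l.1; right; left; omega

theorem Vok.close {L R : Ed n} {o : ℤ} (h : Vok L o R) (hl : R.l = ib L.l) (h1 : L.l.1 ∈ L.ty)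
    (h2 : R.l.1 ∈ R.ty) (c1 : L.ty.card ≤ 2) (c2 : R.ty.card ≤ 2) :
    6 ≤ o ∨ (L.ty = R.ty ∧ L.ty.card = 2 ∧ 4 ≤ o) := by
  have hlab : R.l.1 = L.l.1 := by rw [hl]; rfl
  rcases h with ⟨_, _, h⟩ | h | ⟨g, g1, g2, h⟩
  · exact absurd hl h
  · left; exact h
  · by_cases hg : g = L.l.1
    · left; rw [hlab, hg, ang_self] at h; omega
    · right
      have e1 : {L.l.1, g} = L.ty := by
        apply Finset.eq_of_subset_of_card_le
        · intro x hx; simp only [Finset.mem_insert, Finset.mem_singleton] at hx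
          rcases hx with rfl | rfl <;> assumption
        · rw [Finset.card_pair (Ne.symm hg)]; exact c1
      have e2 : {L.l.1, g} = R.ty := by
        apply Finset.eq_of_subset_of_card_le
        · intro x hx; simp only [Finset.mem_insert, Finset.mem_singleton] at hx
          rcases hx with rfl | rfl
          · rw [← hlab]; exact h2
          · assumption
        · rw [Finset.card_pair (Ne.symm hg)]; exact c2
      refine ⟨e1.symm.trans e2, ?_, ?_⟩
      · rw [← e1, Finset.card_pair (Ne.symm hg)]
      · have := ang_ge L.l.1 g; have := ang_ge g R.l.1; omega

/-- sum of defects -/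
def sm (xs : List (Ed n)) : ℤ := (xs.map (fun x => x.o - 3)).sum

theorem sm_nil : sm ([] : List (Ed n)) = 0 := rfl
theorem sm_cons (e : Ed n) (x) : sm (e :: x) = (e.o - 3) + sm x := by simp [sm]
theorem sm_append (x y : List (Ed n)) : sm (x ++ y) = sm x + sm y := by simp [sm]

variable (n M) in
/-- the invariant -/
structure Inv (k : ℕ) (o0 : ℤ) (xs : List (Ed n)) : Prop where
  mn : ∀ j, Ar n M j (fg xs) → k ≤ j
  lab : ∀ x ∈ xs, x.l.1 ∈ x.ty ∧ x.ty.card ≤ 2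
  adj : xs.IsChain (fun e f => Vok e e.o f)
  base : ∀ α a b β, xs = α ++ [a] → xs = b :: β → Vok a (a.o + o0) b
  bnil : xs = [] → 6 ≤ o0
  ins : ∀ α e β, xs = α ++ e :: β → e.ty.card = 2 → ∀ ρ ∈ Zq n M e.ty, ∀ j,
    Ar n M j (fg α * ρ * fg (e :: β)) → k ≤ j
  par : ∀ α e β f γ, xs = α ++ e :: (β ++ f :: γ) → e.ty = f.ty → e.ty.card = 2 →
    (artinMk n M (fg (e :: (β ++ [f]))) ≠ 1) ∨
    (∃ g, ∀ j, Ar n M j (fg α * g * fg (e :: (β ++ [f])) * g⁻¹ * fg γ) → k + 1 ≤ j) ∨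
    (e.o - 3) + sm β ≤ 0

theorem Zq_conj {q : Finset (Fin n)} {g c : FreeGroup (Fin n)} (hg : g ∈ Zq n M q)
    (hc : c ∈ Subgroup.closure (FreeGroup.of '' (q : Set (Fin n)))) : c * g * c⁻¹ ∈ Zq n M q :=
  ⟨Subgroup.mul_mem _ (Subgroup.mul_mem _ hc hg.1) (Subgroup.inv_mem _ hc), (inferInstance : (Nq n M q).Normal).conj_mem _ hg.2 c⟩

theorem fw_mem {q : Finset (Fin n)} {w : List (Fin n × Bool)} (h : ∀ l ∈ w, l.1 ∈ q) :
    fw w ∈ Subgroup.closure (FreeGroup.of '' (q : Set (Fin n))) :=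
  mem_closure_iff.2 ⟨w, h, rfl⟩

theorem lt_mem {q : Finset (Fin n)} {e : Fin n × Bool} (h : e.1 ∈ q) :
    lt e ∈ Subgroup.closure (FreeGroup.of '' (q : Set (Fin n))) :=
  mem_closure_iff.2 ⟨[e], by simpa using h, rfl⟩

/-- first piece of a fold -/
theorem Inv.left {ku kv : ℕ} {o0 : ℤ} {e e' : Ed n} {u v : List (Ed n)}
    (h : Inv n M (ku + kv) o0 (e :: (u ++ e' :: v))) (hl : e'.l = ib e.l)
    (hv : Ar n M kv (fg v)) (hu : u = [] → 6 ≤ e.o) : Inv n M ku e.o u := by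
  have key : ∀ (g : FreeGroup (Fin n)) j, Ar n M j g →
      Ar n M (j + kv) (lt e.l * g * (lt e.l)⁻¹ * fg v) := fun g j hj =>
    AreaLe.mul (AreaLe.conj hj _) hv
  constructor
  · intro j hj
    have := h.mn (j + kv) (by
      have := key _ _ hj
      simpa [fg_cons, fg_append, hl, lt_ib, mul_assoc] using this)
    omega
  · intro x hx; exact h.lab x (by simp [hx])
  · have := h.adj
    rw [List.isChain_cons] at this
    exact (List.isChain_append.1 this.2).1
  · intro α a b β h1 h2
    have hchain := h.adj
    have c1 : Vok e e.o b := by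
      rw [h2, List.cons_append, List.isChain_cons_cons] at hchain
      exact hchain.1
    have c2 : Vok a a.o e' := by
      rw [h1] at hchain
      have : (e :: (α ++ [a] ++ e' :: v)) = (e :: α) ++ a :: e' :: v := by simp
      rw [this, List.isChain_append_cons_cons] at hchain
      exact hchain.2.1
    refine c2.merge c1 (by rw [hl]; rfl) (h.lab e' (by simp)).1 (h.lab e (by simp)).1
  · exact hu
  · intro α x β h1 hc ρ hρ j hj
    have := h.ins (e :: α) x (β ++ e' :: v) (by simp [h1]) hc ρ hρ (j + kv) (by
      have := key _ _ hj
      simpa [fg_cons, fg_append, hl, lt_ib, mul_assoc] using this)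
    omega
  · intro α x β f γ h1 hty hc
    rcases h.par (e :: α) x β f (γ ++ e' :: v) (by simp [h1]) hty hc with h2 | ⟨g, hg⟩ | h2
    · left; exact h2
    · right; left
      refine ⟨g, fun j hj => ?_⟩
      have := hg (j + kv) (by
        have := key _ _ hj
        simpa [fg_cons, fg_append, hl, lt_ib, mul_assoc] using this)
      omega
    · right; right; exact h2

theorem Inv.right {ku kv : ℕ} {o0 : ℤ} {e e' : Ed n} {u v : List (Ed n)}
    (h : Inv n M (ku + kv) o0 (e :: (u ++ e' :: v))) (hl : e'.l = ib e.l)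
    (hu : Ar n M ku (fg u)) (hv : v = [] → 6 ≤ o0 + e'.o) : Inv n M kv (o0 + e'.o) v := by
  have key : ∀ (g : FreeGroup (Fin n)) j, Ar n M j g →
      Ar n M (ku + j) (lt e.l * fg u * (lt e.l)⁻¹ * g) := fun g j hj =>
    AreaLe.mul (AreaLe.conj hu _) hj
  constructor
  · intro j hj
    have := h.mn (ku + j) (by
      have := key _ _ hj
      simpa [fg_cons, fg_append, hl, lt_ib, mul_assoc] using this)
    omega
  · intro x hx; exact h.lab x (by simp [hx])
  · have := h.adj
    rw [List.isChain_cons] at this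
    have := (List.isChain_append.1 this.2).2.1
    rw [List.isChain_cons] at this
    exact this.2
  · intro α a b β h1 h2
    have hchain := h.adj
    have c1 : Vok e' e'.o b := by
      rw [h2] at hchain
      have : (e :: (u ++ e' :: b :: β)) = (e :: u) ++ e' :: b :: β := by simp
      rw [this, List.isChain_append_cons_cons] at hchain
      exact hchain.2.1
    have c2 := h.base (e :: (u ++ e' :: α)) a e (u ++ e' :: v) (by simp [h1]) rfl
    have := c2.merge c1 (by rw [hl]; rfl) (h.lab e (by simp)).1 (h.lab e' (by simp)).1
    rwa [add_assoc] at this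
  · exact hv
  · intro α x β h1 hc ρ hρ j hj
    have := h.ins (e :: (u ++ e' :: α)) x β (by simp [h1]) hc ρ hρ (ku + j) (by
      have := key _ _ hj
      simpa [fg_cons, fg_append, hl, lt_ib, mul_assoc] using this)
    omega
  · intro α x β f γ h1 hty hc
    rcases h.par (e :: (u ++ e' :: α)) x β f γ (by simp [h1]) hty hc with h2 | ⟨g, hg⟩ | h2
    · left; exact h2
    · right; left
      refine ⟨g, fun j hj => ?_⟩
      have := hg (ku + j) (by
        have := key _ _ hj
        simpa [fg_cons, fg_append, hl, lt_ib, mul_assoc] using this)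
      omega
    · right; right; exact h2

end
end VK

namespace VK
section
variable {n : ℕ} {M : Fin n → Fin n → ℕ∞}

/-- decorate the new arc of a cell -/
def dec (q : Finset (Fin n)) (e : Fin n × Bool) (oe : ℤ) : List (Fin n × Bool) → List (Ed n)
  | [] => []
  | [a] => [⟨a, q, ang a.1 e.1 + oe⟩]
  | a :: b :: t => ⟨a, q, ang a.1 b.1⟩ :: dec q e oe (b :: t)

variable {q : Finset (Fin n)} {e : Fin n × Bool} {oe : ℤ}

theorem dec_map (s : List (Fin n × Bool)) : (dec q e oe s).map Ed.l = s := by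
  induction s with
  | nil => rfl
  | cons a s ih =>
    cases s with
    | nil => rfl
    | cons b s => simp [dec, ih]

theorem fg_dec (s : List (Fin n × Bool)) : fg (dec q e oe s) = fw s := by
  rw [fg, dec_map]

theorem dec_ty (s : List (Fin n × Bool)) : ∀ x ∈ dec q e oe s, x.ty = q ∧ x.l ∈ s := by
  induction s with
  | nil => intro x hx; simp [dec] at hx
  | cons a s ih =>
    cases s with
    | nil => intro x hx; simp [dec] at hx; simp [hx]
    | cons b s =>
      intro x hx
      simp only [dec, List.mem_cons] at hx
      rcases hx with rfl | hx
      · simp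
      · have := ih x hx
        exact ⟨this.1, List.mem_cons_of_mem _ this.2⟩

theorem ang_eq (a b : Fin n) : ang a b = 3 - (if a = b then 0 else 1) := by
  unfold ang; split_ifs <;> norm_num

theorem sm_dec (s : List (Fin n × Bool)) (hs : s ≠ []) :
    sm (dec q e oe s) = oe - chg (s ++ [e]) := by
  induction s with
  | nil => exact absurd rfl hs
  | cons a s ih =>
    cases s with
    | nil => simp [dec, sm_cons, sm_nil, chg, ang_eq]; ring
    | cons b s =>
      rw [dec, sm_cons, ih (by simp)]
      simp only [List.cons_append, chg, ang_eq]; ring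

theorem red_iff (a b : Fin n × Bool) : (a.1 = b.1 → a.2 = b.2) ↔ b ≠ ib a := by
  rcases a with ⟨a1, a2⟩
  rcases b with ⟨b1, b2⟩
  simp only [ib, ne_eq, Prod.mk.injEq, not_and]
  constructor
  · intro h h1 h2
    have := h h1.symm
    subst h2; cases a2 <;> simp at this
  · intro h h1
    have := h h1.symm
    cases a2 <;> cases b2 <;> simp_all

theorem dec_last (s : List (Fin n × Bool)) (hred : FreeGroup.IsReduced (s ++ [e])) :
    ∀ α a, dec q e oe s = α ++ [a] → Vok a (a.o - oe) ⟨e, q, 0⟩ := by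
  induction s with
  | nil => intro α a h; simp [dec] at h
  | cons c s ih =>
    cases s with
    | nil =>
      intro α a h
      have h' : [(⟨c, q, ang c.1 e.1 + oe⟩ : Ed n)] = α ++ [a] := h
      have : α = [] ∧ (⟨c, q, ang c.1 e.1 + oe⟩ : Ed n) = a := by
        cases α with
        | nil =>
          simp only [List.nil_append, List.cons.injEq, and_true] at h'
          exact ⟨rfl, h'⟩
        | cons d α =>
          exfalso
          have := congrArg List.length h'
          simp at this
      obtain ⟨rfl, rfl⟩ := this
      left
      refine ⟨rfl, by simp, ?_⟩
      have := (List.isChain_cons_cons.1 hred).1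
      exact (red_iff _ _).1 this
    | cons b s =>
      intro α a h
      cases α with
      | nil =>
        exfalso
        have := congrArg (List.map Ed.l) h
        rw [dec_map] at this; simp at this
      | cons d α =>
        simp only [dec, List.cons_append, List.cons.injEq] at h
        exact ih (List.isChain_cons_cons.1 hred).2 α a h.2

theorem dec_chain (s : List (Fin n × Bool)) (hred : FreeGroup.IsReduced s) :
    (dec q e oe s).IsChain (fun e f => Vok e e.o f) := by
  induction s with
  | nil => simp [dec]
  | cons a s ih =>
    cases s with
    | nil => simp [dec]
    | cons b s =>
      have h1 := ih (List.isChain_cons_cons.1 hred).2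
      have h2 := (red_iff _ _).1 (List.isChain_cons_cons.1 hred).1
      cases s with
      | nil =>
        simp only [dec, List.isChain_cons_cons, List.isChain_singleton, and_true]
        exact Or.inl ⟨rfl, le_rfl, h2⟩
      | cons c s =>
        simp only [dec, List.isChain_cons_cons] at h1 ⊢
        exact ⟨Or.inl ⟨rfl, le_rfl, h2⟩, h1⟩

theorem dec_flat (s : List (Fin n × Bool)) : ∀ δ f γ, dec q e oe s = δ ++ f :: γ →
    ∀ x ∈ δ, x.o ≤ 3 := by
  induction s with
  | nil => intro δ f γ h; simp [dec] at h
  | cons a s ih =>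
    cases s with
    | nil =>
      intro δ f γ h x hx
      have := congrArg List.length h
      simp only [dec, List.length_append, List.length_cons, List.length_nil] at this
      have : δ = [] := List.length_eq_zero_iff.1 (by omega)
      simp [this] at hx
    | cons b s =>
      intro δ f γ h x hx
      cases δ with
      | nil => simp at hx
      | cons d δ =>
        simp only [dec, List.cons_append, List.cons.injEq] at h
        rcases List.mem_cons.1 hx with rfl | hx
        · rw [← h.1]; exact ang_le _ _
        · exact ih δ f γ h.2 x hx

theorem sm_nonpos (δ : List (Ed n)) (h : ∀ x ∈ δ, x.o ≤ 3) : sm δ ≤ 0 := by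
  induction δ with
  | nil => simp [sm_nil]
  | cons a δ ih =>
    rw [sm_cons]
    have := ih fun x hx => h x (by simp [hx])
    have := h a (by simp)
    omega

theorem Inv.cell {k : ℕ} {o0 : ℤ} {e : Ed n} {x : List (Ed n)} {s1 : Fin n × Bool}
    {t : List (Fin n × Bool)}
    (h : Inv n M (k + 1) o0 (e :: x)) (hq : q.card = 2)
    (hl : ∀ l ∈ ib e.l :: s1 :: t, l.1 ∈ q) (hN : FreeGroup.mk (ib e.l :: s1 :: t) ∈ Nq n M q)
    (hred : FreeGroup.IsReduced (ib e.l :: s1 :: t ++ [ib e.l])) :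
    Inv n M k (o0 + ang e.l.1 s1.1) (dec q (ib e.l) e.o (s1 :: t) ++ x) := by
  have heq : e.l.1 ∈ q := hl (ib e.l) (by simp)
  have hsq : ∀ l ∈ s1 :: t, l.1 ∈ q := fun l hl' => hl l (by simp at *; tauto)
  have hFs := fw_mem hsq
  have hFe := lt_mem heq
  set s := s1 :: t with hs
  have hz0 : lt e.l * (fw s)⁻¹ ∈ Zq n M q := by
    refine ⟨Subgroup.mul_mem _ hFe (Subgroup.inv_mem _ hFs), ?_⟩
    have h1 : (lt e.l)⁻¹ * fw s ∈ Nq n M q := by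
      have : FreeGroup.mk (ib e.l :: s) = (lt e.l)⁻¹ * fw s := mk_ib_cons e.l s
      rwa [this] at hN
    have h2 := inv_mem ((inferInstance : (Nq n M q).Normal).mem_comm h1)
    simpa using h2
  have key : ∀ z ∈ Zq n M q, ∀ j g, Ar n M j g → Ar n M (j + 1) (z * g) := by
    intro z hz j g hg
    rw [add_comm]; exact AreaLe.mul (Zq_area hq hz) hg
  have hredS : FreeGroup.IsReduced (s ++ [ib e.l]) := by
    have : ib e.l :: s1 :: t ++ [ib e.l] = ib e.l :: s1 :: (t ++ [ib e.l]) := rfl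
    rw [this] at hred
    exact (List.isChain_cons_cons.1 hred).2
  have hred1 : FreeGroup.IsReduced s := (List.isChain_append.1 hredS).1
  have vin : ∀ b : Ed n, b.l = s1 → b.ty = q → Vok ⟨ib e.l, q, 0⟩ (ang e.l.1 s1.1) b := by
    intro b h1 h2
    left
    refine ⟨h2.symm, by rw [h1]; exact le_rfl, ?_⟩
    have : ib e.l :: s1 :: t ++ [ib e.l] = ib e.l :: s1 :: (t ++ [ib e.l]) := rfl
    rw [this] at hred
    have := (List.isChain_cons_cons.1 hred).1
    rw [h1]; exact (red_iff _ _).1 this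
  have hbig : ∀ b β, dec q (ib e.l) e.o s = b :: β → b.l = s1 ∧ b.ty = q := by
    intro b β hb
    have h1 := congrArg (List.map Ed.l) hb
    rw [dec_map, hs] at h1
    simp only [List.map_cons, List.cons.injEq] at h1
    exact ⟨h1.1.symm, (dec_ty s b (by rw [hb]; simp)).1⟩
  have hne : dec q (ib e.l) e.o s ≠ [] := by
    intro h0
    have h1 := congrArg (List.map Ed.l) h0
    rw [dec_map, hs] at h1
    simp at h1
  have hel := h.lab e (by simp)
  constructor
  · intro j hj
    rw [fg_append, fg_dec] at hj
    have := h.mn (j + 1) (by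
      have := key _ hz0 _ _ hj
      simpa [fg_cons, mul_assoc] using this)
    omega
  · intro y hy
    rcases List.mem_append.1 hy with hy | hy
    · have := dec_ty s y hy
      exact ⟨by rw [this.1]; exact hsq _ this.2, by rw [this.1, hq]⟩
    · exact h.lab y (by simp [hy])
  · rw [List.isChain_append]
    refine ⟨dec_chain s hred1, (List.isChain_cons.1 h.adj).2, ?_⟩
    intro a ha f hf
    obtain ⟨α, hα⟩ := List.getLast?_eq_some_iff.1 ha
    have h1 := dec_last s hredS α a hα
    have h2 : Vok e e.o f := (List.isChain_cons.1 h.adj).1 f hf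
    have := h1.merge h2 rfl heq hel.1
    simpa using this
  · intro α a b β h1 h2
    have hb : b.l = s1 ∧ b.ty = q := by
      cases hd : dec q (ib e.l) e.o s with
      | nil => exact absurd hd hne
      | cons b' β' =>
        rw [hd] at h2
        simp only [List.cons_append, List.cons.injEq] at h2
        rw [← h2.1]; exact hbig b' β' hd
    have v1 := vin b hb.1 hb.2
    rcases List.eq_nil_or_concat x with hx | ⟨x', c, hx⟩
    · subst hx
      have h3 := dec_last s hredS α a (by simpa using h1)
      have h4 := h.base [] e e [] rfl rfl
      have h5 := h3.merge h4 rfl heq hel.1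
      have h6 := h5.merge v1 rfl hel.1 heq
      have : a.o - e.o + (e.o + o0) + ang e.l.1 s1.1 = a.o + (o0 + ang e.l.1 s1.1) := by ring
      rwa [this] at h6
    · rw [List.concat_eq_append] at hx
      have hac : a = c := by
        rw [hx, ← List.append_assoc] at h1
        have := (List.append_inj' h1 rfl).2
        simpa using this.symm
      have h4 := h.base (e :: x') a e x (by rw [hx, hac]; rfl) rfl
      have h6 := h4.merge v1 rfl hel.1 heq
      rwa [add_assoc] at h6
  · intro h0; exact absurd (List.append_eq_nil_iff.1 h0).1 hne
  · intro α f β h1 hc ρ hρ j hj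
    rcases split_lem h1 with ⟨b, h2, h3⟩ | ⟨a, h2, h3⟩
    · -- new letter
      have hf := dec_ty s f (by rw [h2]; simp)
      rw [hf.1] at hρ
      have hα : fg α ∈ Subgroup.closure (FreeGroup.of '' (q : Set (Fin n))) := by
        apply fw_mem
        intro l hl'
        obtain ⟨y, hy, rfl⟩ := List.mem_map.1 hl'
        exact hsq _ (dec_ty s y (by rw [h2]; simp [hy])).2
      have hz : (fg α * ρ * (fg α)⁻¹)⁻¹ ∈ Zq n M q := inv_mem (Zq_conj hρ hα)
      have hS : fg α * fg (f :: b) = fw s := by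
        rw [← fg_dec (q := q) (e := ib e.l) (oe := e.o) s, h2, fg_append]
      have hS2 : fg (f :: β) = (fg α)⁻¹ * (fw s * fg x) := by
        rw [← hS, h3, fg_cons, fg_append, fg_cons]; group
      have := h.mn (j + 1) (by
        have := key _ (mul_mem hz0 hz) _ _ hj
        rw [hS2] at this
        rw [fg_cons]
        convert this using 1
        group)
      omega
    · have := h.ins (e :: a) f β (by rw [h3]; rfl) hc ρ hρ (j + 1) (by
        have := key _ hz0 _ _ hj
        rw [h2, fg_append, fg_dec] at this
        rw [fg_cons]
        convert this using 1
        group)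
      omega
  · intro α f β f' γ h1 hty hc
    rcases split_lem h1 with ⟨b, h2, h3⟩ | ⟨a, h2, h3⟩
    · have hf := dec_ty s f (by rw [h2]; simp)
      rcases split_lem h3.symm with ⟨c, h4, h5⟩ | ⟨c, h4, h5⟩
      · -- both new
        right; right
        have := dec_flat s (α ++ f :: β) f' c (by rw [h2, h4]; simp)
        have h6 := sm_nonpos (f :: β) (fun y hy => this y (by simp at *; tauto))
        rwa [sm_cons] at h6
      · -- f new, second old
        right; left
        have hα : fg α ∈ Subgroup.closure (FreeGroup.of '' (q : Set (Fin n))) := by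
          apply fw_mem
          intro l hl'
          obtain ⟨y, hy, rfl⟩ := List.mem_map.1 hl'
          exact hsq _ (dec_ty s y (by rw [h2]; simp [hy])).2
        have hS : fw s = fg α * (lt f.l * fg b) := by
          rw [← fg_dec (q := q) (e := ib e.l) (oe := e.o) s, h2, fg_append, fg_cons]
        have hfq : f'.l.1 ∈ q := by
          rw [← hf.1, hty]; exact (h.lab f' (by rw [h5]; simp)).1
        have hz' : lt f'.l * ((fg α)⁻¹ * (lt e.l * (fw s)⁻¹)⁻¹ * (fg α)⁻¹⁻¹) * (lt f'.l)⁻¹ ∈ Zq n M q :=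
          Zq_conj (Zq_conj (inv_mem hz0) (Subgroup.inv_mem _ hα)) (lt_mem hfq)
        refine ⟨(fg α)⁻¹ * lt e.l * (lt f.l * fg b)⁻¹, fun j hj => ?_⟩
        refine h.ins (e :: c) f' γ (by rw [h5]; rfl) (by rw [← hty]; exact hc) _
          (by rw [← hty, hf.1]; exact hz') j ?_
        convert hj using 1
        simp only [h4, fg_cons, fg_append, fg_nil, hS]
        group
    · -- both old
      rcases h.par (e :: a) f β f' γ (by rw [h3]; rfl) hty hc with h4 | ⟨g, hg⟩ | h4
      · left; exact h4
      · right; left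
        refine ⟨g, fun j hj => ?_⟩
        have := hg (j + 1) (by
          have := key _ hz0 _ _ hj
          rw [h2, fg_append, fg_dec] at this
          rw [fg_cons]
          convert this using 1
          group)
        omega
      · right; right; exact h4

end
end VK

namespace VK
section
variable {n : ℕ} {M : Fin n → Fin n → ℕ∞}

variable (n M) in
/-- Artin group -/
abbrev GA := PresentedGroup (artinRels n M)

/-- integral along a path -/
def J (ω : GA n M → Fin n × Bool → ℝ) : GA n M → List (Fin n × Bool) → ℝ
  | _, [] => 0
  | h, e :: x => ω h e + J ω (h * artinMk n M (lt e)) x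

theorem J_append (ω : GA n M → Fin n × Bool → ℝ) (u v : List (Fin n × Bool)) (h : GA n M) :
    J ω h (u ++ v) = J ω h u + J ω (h * artinMk n M (fw u)) v := by
  induction u generalizing h with
  | nil => simp [J, fw_nil]
  | cons a u ih => simp [J, ih, fw_cons, mul_assoc, add_assoc]

theorem main_curv (hsym : ∀ i j, M i j = M j i) (hM : ∀ i j, i ≠ j → 7 ≤ M i j)
    (ω : GA n M → Fin n × Bool → ℝ) (C : ℝ) (hC : 0 ≤ C)
    (hanti : ∀ h e, ω (h * artinMk n M (lt e)) (ib e) = - ω h e)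
    (hrel : ∀ w, RR n M w → ∀ h, |J ω h w| ≤ C * ((cyc w : ℝ) - 6))
    {k : ℕ} {w : List (Fin n × Bool)} (hD : D (RR n M) k w) :
    ∀ (o0 : ℤ) (xs : List (Ed n)), xs.map Ed.l = w → Inv n M k o0 xs →
      (6 ≤ o0 + sm xs) ∧ ∀ h, |J ω h w| ≤ C * (((o0 + sm xs : ℤ) : ℝ) - 6) := by
  induction hD with
  | nil =>
    intro o0 xs hx hI
    have : xs = [] := by simpa using hx
    subst this
    have h6 := hI.bnil rfl
    refine ⟨by simpa [sm_nil] using h6, fun h => ?_⟩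
    have : (6 : ℝ) ≤ o0 := by exact_mod_cast h6
    simp only [J, sm_nil, abs_zero, add_zero]
    exact mul_nonneg hC (by linarith)
  | @fold ku kv e0 u0 v0 du dv ihu ihv =>
    intro o0 xs hx hI
    obtain ⟨e, xs', rfl, rfl, hx'⟩ := List.map_eq_cons_iff.1 hx
    obtain ⟨u, xs'', rfl, rfl, hx''⟩ := List.map_eq_append_iff.1 hx'
    obtain ⟨e', v, rfl, hl, rfl⟩ := List.map_eq_cons_iff.1 hx''
    have hu : Ar n M ku (fg u) := ⟨_, ku, le_rfl, rfl, du⟩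
    have hv : Ar n M kv (fg v) := ⟨_, kv, le_rfl, rfl, dv⟩
    have l1 := hI.lab e (by simp)
    have l2 := hI.lab e' (by simp)
    have huV : artinMk n M (fg u) = 1 := hu.value
    have hne : ¬ (e.ty = e'.ty ∧ e.ty.card = 2) := by
      rintro ⟨h1, h2⟩
      rcases hI.par [] e u e' v rfl h1 h2 with h3 | ⟨g, h3⟩ | h3
      · apply h3
        simp [fg_cons, fg_append, hl, lt_ib, huV, fg_nil]
      · have := h3 (ku + kv) (by
          have : Ar n M (ku + kv) _ := AreaLe.mul (AreaLe.conj hu (g * lt e.l)) hv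
          simpa [fg_cons, fg_append, hl, lt_ib, fg_nil, mul_assoc] using this)
        omega
      · by_cases hun : u = []
        · subst hun
          have hc : Vok e e.o e' := (List.isChain_cons_cons.1 hI.adj).1
          rcases hc.close hl l1.1 l2.1 l1.2 l2.2 with h4 | h4 <;> simp [sm_nil] at h3 <;> omega
        · have := (ihu e.o u rfl (hI.left hl hv (fun h => absurd h hun))).1
          omega
    have hu6 : u = [] → 6 ≤ e.o := by
      rintro rfl
      have hc : Vok e e.o e' := (List.isChain_cons_cons.1 hI.adj).1
      rcases hc.close hl l1.1 l2.1 l1.2 l2.2 with h4 | h4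
      · exact h4
      · exact absurd ⟨h4.1, h4.2.1⟩ hne
    have hv6 : v = [] → 6 ≤ o0 + e'.o := by
      rintro rfl
      have hc := hI.base (e :: u) e' e (u ++ [e']) (by simp) rfl
      have hl' : e.l = ib e'.l := by rw [hl, ib_ib]
      rcases hc.close hl' l2.1 l1.1 l2.2 l1.2 with h4 | h4
      · omega
      · exact absurd ⟨h4.1.symm, h4.1 ▸ h4.2.1⟩ hne
    obtain ⟨a1, a2⟩ := ihu e.o u rfl (hI.left hl hv hu6)
    obtain ⟨b1, b2⟩ := ihv (o0 + e'.o) v rfl (hI.right hl hu hv6)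
    have hS : o0 + sm (e :: (u ++ e' :: v)) = (e.o + sm u) + ((o0 + e'.o) + sm v) - 6 := by
      simp only [sm_cons, sm_append]; ring
    refine ⟨by omega, fun h => ?_⟩
    rw [hS]
    have hJ : J ω h (e.l :: (List.map Ed.l u ++ ib e.l :: List.map Ed.l v))
        = J ω (h * artinMk n M (lt e.l)) (u.map Ed.l) + J ω h (v.map Ed.l) := by
      have huV' : artinMk n M (fw (u.map Ed.l)) = 1 := huV
      simp only [J, J_append, huV', mul_one, hanti, lt_ib, map_inv, mul_inv_cancel_right]
      ring
    rw [hJ]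
    have := abs_add_le (J ω (h * artinMk n M (lt e.l)) (u.map Ed.l)) (J ω h (v.map Ed.l))
    have a3 := a2 (h * artinMk n M (lt e.l))
    have b3 := b2 h
    push_cast at *
    nlinarith
  | @cell k e0 s x0 hR dx ih =>
    intro o0 xs hx hI
    obtain ⟨e, x, rfl, rfl, rfl⟩ := List.map_eq_cons_iff.1 hx
    have h8 := RR_cyc hsym hM hR
    have hR' := hR
    obtain ⟨q, hq, hl, hN, -, hcr⟩ := hR
    cases s with
    | nil => simp [cyc, chg] at h8
    | cons s1 t =>
      have hred : FreeGroup.IsReduced (ib e.l :: s1 :: t ++ [ib e.l]) := by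
        unfold FreeGroup.IsReduced
        rw [List.isChain_append]
        refine ⟨hcr.1, List.isChain_singleton _, ?_⟩
        intro a ha b hb
        have hb' : b = ib e.l := by simpa using hb.symm
        subst hb'
        exact hcr.2 a ha (ib e.l) (by simp)
      have hI' := hI.cell hq hl hN hred
      obtain ⟨a1, a2⟩ := ih _ _ (by rw [List.map_append, dec_map]) hI'
      have hcyc : cyc (ib e.l :: s1 :: t) = (3 - ang e.l.1 s1.1) + chg (s1 :: t ++ [ib e.l]) := by
        simp only [cyc, List.head?_cons, Option.toList, List.cons_append, chg, ang_eq]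
        by_cases hh : e.l.1 = s1.1 <;> simp [ib, hh]
      have hS : o0 + ang e.l.1 s1.1 + sm (dec q (ib e.l) e.o (s1 :: t) ++ x) =
          o0 + sm (e :: x) + 6 - cyc (ib e.l :: s1 :: t) := by
        rw [sm_append, sm_dec _ (by simp), sm_cons, hcyc]; ring
      rw [hS] at a1 a2
      refine ⟨by omega, fun h => ?_⟩
      have r1 := hrel _ hR' (h * artinMk n M (lt e.l))
      have hval : artinMk n M (fw (ib e.l :: s1 :: t)) = 1 := RR_value _ hR'
      have hval' : artinMk n M (fw (s1 :: t)) = artinMk n M (lt e.l) := by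
        rw [fw_cons (ib e.l), lt_ib, map_mul, map_inv, inv_mul_eq_one] at hval
        exact hval.symm
      have hJ : J ω h (e.l :: x.map Ed.l) = J ω h ((s1 :: t) ++ x.map Ed.l)
          - J ω (h * artinMk n M (lt e.l)) (ib e.l :: s1 :: t) := by
        rw [J_append, hval', J, J.eq_2 ω _ (ib e.l)]
        rw [hanti, lt_ib, map_inv, mul_inv_cancel_right]
        ring
      rw [hJ]
      have a3 := a2 h
      have := abs_sub (J ω h ((s1 :: t) ++ x.map Ed.l))
        (J ω (h * artinMk n M (lt e.l)) (ib e.l :: s1 :: t))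
      push_cast at *
      nlinarith

end
end VK

namespace VK
section
variable {n : ℕ} {M : Fin n → Fin n → ℕ∞}

/-- finite type -/
def FinQ (M : Fin n → Fin n → ℕ∞) (q : Finset (Fin n)) : Prop :=
  q.card = 2 ∧ ∀ i ∈ q, ∀ j ∈ q, i ≠ j → M i j ≠ ⊤

variable (n M) in
/-- parabolic of type q -/
def HH (q : Finset (Fin n)) : Subgroup (GA n M) :=
  (Subgroup.closure (FreeGroup.of '' (q : Set (Fin n)))).map (artinMk n M)

variable (n M) in
/-- generating set -/
def XX : Set (GA n M) :=
  {s | (∃ q, FinQ M q ∧ s ∈ HH n M q) ∨ ∃ l, s = artinMk n M (lt l)}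

/-- one Lipschitz function -/
def Lip (f : GA n M → ℝ) : Prop := ∀ h, ∀ s ∈ XX n M, |f (h * s) - f h| ≤ 1

theorem HH_word {q : Finset (Fin n)} {w : List (Fin n × Bool)} (h : ∀ l ∈ w, l.1 ∈ q) :
    artinMk n M (fw w) ∈ HH n M q := Subgroup.mem_map_of_mem _ (fw_mem h)

theorem HH_lt {q : Finset (Fin n)} {e : Fin n × Bool} (h : e.1 ∈ q) :
    artinMk n M (lt e) ∈ HH n M q := Subgroup.mem_map_of_mem _ (lt_mem h)

theorem HH_exists {q : Finset (Fin n)} {s : GA n M} (h : s ∈ HH n M q) :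
    ∃ w : List (Fin n × Bool), (∀ l ∈ w, l.1 ∈ q) ∧ artinMk n M (fw w) = s := by
  obtain ⟨g, hg, rfl⟩ := h
  obtain ⟨w, hw, rfl⟩ := mem_closure_iff.1 hg
  exact ⟨w, hw, rfl⟩

/-- generator -/
def gen (i : Fin n) : GA n M := artinMk n M (lt (i, true))

theorem lt_zpow (e : Fin n × Bool) : artinMk n M (lt e) ∈ Subgroup.zpowers (gen (M := M) e.1) := by
  rcases e with ⟨i, b⟩
  cases b
  · have : lt (i, false) = (lt (i, true))⁻¹ := lt_ib (i, true)
    rw [this, map_inv]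
    exact Subgroup.inv_mem _ (Subgroup.mem_zpowers _)
  · exact Subgroup.mem_zpowers _

open Classical in
/-- coefficient -/
noncomputable def FF (f : GA n M → ℝ) (h : GA n M) (i : Fin n) : ℝ :=
  if ∃ q, FinQ M q ∧ i ∈ q then
    f (Quotient.out (QuotientGroup.mk h : GA n M ⧸ Subgroup.zpowers (gen (M := M) i)))
  else f h

/-- form -/
noncomputable def om (f g : GA n M → ℝ) (h : GA n M) (e : Fin n × Bool) : ℝ :=
  if e.2 then FF f h e.1 * (g (h * artinMk n M (lt e)) - g h)
  else FF f (h * artinMk n M (lt e)) e.1 * (g (h * artinMk n M (lt e)) - g h)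

theorem om_anti (f g : GA n M → ℝ) (h : GA n M) (e : Fin n × Bool) :
    om f g (h * artinMk n M (lt e)) (ib e) = - om f g h e := by
  rcases e with ⟨i, b⟩
  have h1 : h * artinMk n M (lt (i, b)) * artinMk n M (lt (ib (i, b))) = h := by
    rw [lt_ib, map_inv, mul_inv_cancel_right]
  unfold om
  rw [h1]
  cases b <;> simp [ib] <;> ring

theorem FF_const {q : Finset (Fin n)} (hq : FinQ M q) {i : Fin n} (hi : i ∈ q) (f : GA n M → ℝ)
    (h : GA n M) {s : GA n M} (hs : s ∈ Subgroup.zpowers (gen (M := M) i)) :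
    FF f (h * s) i = FF f h i := by
  unfold FF
  rw [if_pos ⟨q, hq, hi⟩, if_pos ⟨q, hq, hi⟩]
  congr 2
  rw [QuotientGroup.mk_mul_of_mem _ hs]

theorem om_eq {q : Finset (Fin n)} (hq : FinQ M q) {e : Fin n × Bool} (hi : e.1 ∈ q)
    (f g : GA n M → ℝ) (h : GA n M) :
    om f g h e = FF f h e.1 * (g (h * artinMk n M (lt e)) - g h) := by
  unfold om
  rw [FF_const hq hi f h (lt_zpow e), ite_self]

theorem zp_le {q : Finset (Fin n)} {i : Fin n} (hi : i ∈ q) :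
    Subgroup.zpowers (gen (M := M) i) ≤ HH n M q := by
  rw [Subgroup.zpowers_le]
  exact HH_lt (e := (i, true)) hi

theorem FF_near {q : Finset (Fin n)} (hq : FinQ M q) {i : Fin n} (hi : i ∈ q) (f : GA n M → ℝ)
    (h : GA n M) : ∃ s ∈ HH n M q, FF f h i = f (h * s) := by
  unfold FF
  rw [if_pos ⟨q, hq, hi⟩]
  obtain ⟨s, hs⟩ := QuotientGroup.mk_out_eq_mul (Subgroup.zpowers (gen (M := M) i)) h
  exact ⟨s, zp_le hi s.2, by rw [hs]⟩

theorem block_fine {q : Finset (Fin n)} (hq : FinQ M q) {f g : GA n M → ℝ} (h0 : GA n M) (f0 : ℝ)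
    (hf : ∀ s ∈ HH n M q, |f (h0 * s) - f0| ≤ 1)
    (hg : Lip g) (t : List (Fin n × Bool)) :
    ∀ (e : Fin n × Bool) (s : GA n M), s ∈ HH n M q → (∀ l ∈ e :: t, l.1 ∈ q) →
    ∃ r ∈ HH n M q, |J (om f g) (h0 * s) (e :: t)
      - f0 * (g (h0 * s * artinMk n M (fw (e :: t))) - g (h0 * s))
      - (FF f (h0 * s) e.1 - f0) * (g (h0 * s * r) - g (h0 * s))| ≤ chg (e :: t) := by
  induction t with
  | nil =>
    intro e s hs hl
    have he : e.1 ∈ q := hl e (by simp)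
    refine ⟨artinMk n M (lt e), HH_lt he, ?_⟩
    rw [J, J, om_eq hq he, fw_cons, fw_nil, mul_one]
    simp only [chg, Int.cast_zero]
    rw [show ∀ a b c : ℝ, a * b + 0 - c * b - (a - c) * b = 0 by intros; ring]
    simp
  | cons e2 t ih =>
    intro e s hs hl
    have he : e.1 ∈ q := hl e (by simp)
    have he2 : e2.1 ∈ q := hl e2 (by simp)
    obtain ⟨r, hr, hb⟩ := ih e2 (s * artinMk n M (lt e)) (Subgroup.mul_mem _ hs (HH_lt he))
      (fun l h => hl l (List.mem_cons_of_mem _ h))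
    rw [← mul_assoc] at hb
    rw [J, om_eq hq he, fw_cons, map_mul, ← mul_assoc]
    set y := h0 * s with hy
    by_cases h12 : e.1 = e2.1
    · refine ⟨artinMk n M (lt e) * r, Subgroup.mul_mem _ (HH_lt he) hr, ?_⟩
      have hF : FF f (y * artinMk n M (lt e)) e2.1 = FF f y e.1 := by
        rw [← h12]; exact FF_const hq he f y (lt_zpow e)
      rw [hF] at hb
      have : chg (e :: e2 :: t) = chg (e2 :: t) := by simp [chg, h12]
      rw [this, ← mul_assoc]
      refine le_trans (le_of_eq ?_) hb
      congr 1; ring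
    · refine ⟨artinMk n M (lt e), HH_lt he, ?_⟩
      have : chg (e :: e2 :: t) = 1 + chg (e2 :: t) := by simp [chg, h12]
      rw [this]
      obtain ⟨s2, hs2, hF⟩ := FF_near hq he2 f (y * artinMk n M (lt e))
      have b1 : |FF f (y * artinMk n M (lt e)) e2.1 - f0| ≤ 1 := by
        rw [hF, hy, mul_assoc, mul_assoc]
        exact hf _ (Subgroup.mul_mem _ hs (Subgroup.mul_mem _ (HH_lt he) hs2))
      have b2 := hg (y * artinMk n M (lt e)) r (Or.inl ⟨q, hq, hr⟩)
      have b3 := mul_le_mul b1 b2 (abs_nonneg _) zero_le_one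
      rw [← abs_mul] at b3
      have b4 := abs_add_le _ _ |>.trans (add_le_add hb b3)
      push_cast
      refine le_trans (le_of_eq ?_) (b4.trans (by linarith))
      congr 1; ring

theorem block_est {q : Finset (Fin n)} (hq : FinQ M q) {f g : GA n M → ℝ}
    (hf : Lip f) (hg : Lip g) (b : List (Fin n × Bool)) (hb : ∀ l ∈ b, l.1 ∈ q) (h : GA n M) :
    |J (om f g) h b - f h * (g (h * artinMk n M (fw b)) - g h)| ≤ chg b + 1 := by
  cases b with
  | nil => simp [J, fw_nil, chg]
  | cons e t =>
    obtain ⟨r, hr, hb'⟩ := block_fine hq (f := f) h (f h)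
      (fun s hs => hf h s (Or.inl ⟨q, hq, hs⟩)) hg t e 1 (Subgroup.one_mem _) hb
    rw [mul_one] at hb'
    have he : e.1 ∈ q := hb e (by simp)
    obtain ⟨s2, hs2, hF⟩ := FF_near hq he f h
    have b1 : |FF f h e.1 - f h| ≤ 1 := by
      rw [hF]; exact hf _ _ (Or.inl ⟨q, hq, hs2⟩)
    have b2 := hg h r (Or.inl ⟨q, hq, hr⟩)
    have b3 := mul_le_mul b1 b2 (abs_nonneg _) zero_le_one
    rw [← abs_mul] at b3
    have b4 := abs_add_le _ _ |>.trans (add_le_add hb' b3)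
    refine le_trans (le_of_eq ?_) (b4.trans (by linarith))
    congr 1; ring

theorem single_est {f g : GA n M → ℝ} (hf : Lip f) (hg : Lip g) (e : Fin n × Bool) (h : GA n M) :
    |J (om f g) h [e] - f h * (g (h * artinMk n M (fw [e])) - g h)| ≤ 1 := by
  by_cases hex : ∃ q, FinQ M q ∧ e.1 ∈ q
  · obtain ⟨q, hq, he⟩ := hex
    have := block_est hq hf hg [e] (by simpa using he) h
    simpa [chg] using this
  · have hF : ∀ y, FF f y e.1 = f y := fun y => by unfold FF; rw [if_neg hex]
    rw [J, J, fw_cons, fw_nil, mul_one]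
    have b2 := hg h _ (Or.inr ⟨e, rfl⟩)
    have b1 := hf h _ (Or.inr ⟨e, rfl⟩)
    have b3 := mul_le_mul b1 b2 (abs_nonneg _) zero_le_one
    rw [← abs_mul] at b3
    unfold om
    rw [hF, hF]
    split_ifs
    · simp
    · refine le_trans (le_of_eq ?_) (b3.trans (by norm_num))
      congr 1; ring

theorem chg_le_cyc (w : List (Fin n × Bool)) : chg w ≤ cyc w := by
  cases w with
  | nil => simp [cyc]
  | cons e s =>
    simp only [cyc, List.head?_cons, Option.toList]
    induction s generalizing e with
    | nil => simp [chg]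
    | cons e2 s ih =>
      have h := chg_nonneg (e2 :: s ++ [e])
      have : ∀ (s : List (Fin n × Bool)) (e2 e), chg (e2 :: s) ≤ chg (e2 :: s ++ [e]) := by
        intro s
        induction s with
        | nil => intro a b; exact chg_nonneg _
        | cons c s ih => intro a b; have := ih c b; simp only [List.cons_append, chg] at *; omega
      exact this _ _ _

theorem RR_fin (hsym : ∀ i j, M i j = M j i) {w : List (Fin n × Bool)} (hw : RR n M w) :
    ∃ q, FinQ M q ∧ ∀ l ∈ w, l.1 ∈ q := by
  obtain ⟨q, h1, h2, h3, h4, h5⟩ := hw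
  refine ⟨q, ⟨h1, ?_⟩, h2⟩
  intro i hi j hj hij htop
  have hq : ({i, j} : Finset (Fin n)) = q := by
    apply Finset.eq_of_subset_of_card_le
    · intro x hx; simp only [Finset.mem_insert, Finset.mem_singleton] at hx
      rcases hx with rfl | rfl <;> assumption
    · rw [h1, Finset.card_pair hij]
  have : FreeGroup.mk w = 1 := by
    have hN : Nq n M q = ⊥ := by
      unfold Nq
      rw [Subgroup.normalClosure_eq_bot_iff]
      rintro r ⟨a, ha, b, hb, hab, m, hm, rfl⟩
      exfalso
      rw [← hq] at ha hb
      simp only [Finset.mem_insert, Finset.mem_singleton] at ha hb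
      have h' := (hsym j i).trans htop
      rcases ha with rfl | rfl <;> rcases hb with rfl | rfl
      · exact hab rfl
      · rw [htop] at hm; exact ENat.top_ne_natCast _ hm
      · rw [h'] at hm; exact ENat.top_ne_natCast _ hm
      · exact hab rfl
    rw [hN] at h3
    simpa using h3
  have h6 := FreeGroup.isReduced_iff_reduce_eq.1 h5.1
  rw [FreeGroup.one_eq_mk] at this
  have h7 := congrArg FreeGroup.toWord this
  rw [FreeGroup.toWord_mk, FreeGroup.toWord_mk, h6, FreeGroup.reduce_nil] at h7
  exact h4 h7

theorem rel_est (hsym : ∀ i j, M i j = M j i) (hM : ∀ i j, i ≠ j → 7 ≤ M i j)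
    {f g : GA n M → ℝ} (hf : Lip f) (hg : Lip g) (w) (hw : RR n M w) (h : GA n M) :
    |J (om f g) h w| ≤ 8 * ((cyc w : ℝ) - 6) := by
  obtain ⟨q, hq, hl⟩ := RR_fin hsym hw
  have h1 := block_est hq hf hg w hl h
  have h2 : artinMk n M (fw w) = 1 := RR_value _ hw
  rw [h2, mul_one, sub_self, mul_zero, sub_zero] at h1
  have h3 : (8 : ℝ) ≤ cyc w := by exact_mod_cast RR_cyc hsym hM hw
  have h4 : (chg w : ℝ) ≤ cyc w := by exact_mod_cast chg_le_cyc w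
  linarith

end
end VK

namespace VK
section
variable {n : ℕ} {M : Fin n → Fin n → ℕ∞}

/-- blocks -/
abbrev Bl (n : ℕ) := Finset (Fin n) × List (Fin n × Bool)

/-- valid block -/
def Ok (M : Fin n → Fin n → ℕ∞) (b : Bl n) : Prop :=
  (FinQ M b.1 ∧ ∀ l ∈ b.2, l.1 ∈ b.1) ∨ ∃ l : Fin n × Bool, b = ({l.1}, [l])

/-- decorate a block -/
def ble (q : Finset (Fin n)) : List (Fin n × Bool) → List (Ed n)
  | [] => []
  | [a] => [⟨a, q, 6⟩]
  | a :: b :: t => ⟨a, q, ang a.1 b.1⟩ :: ble q (b :: t)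

/-- decorate a path -/
def XF (bs : List (Bl n)) : List (Ed n) := (bs.map (fun b => ble b.1 b.2)).flatten

/-- underlying word -/
def wd (bs : List (Bl n)) : List (Fin n × Bool) := (bs.map Prod.snd).flatten

variable (M) in
/-- value of block -/
def val (b : Bl n) : GA n M := artinMk n M (fw b.2)

/-- discrete integral -/
def II (f g : GA n M → ℝ) : GA n M → List (Bl n) → ℝ
  | _, [] => 0
  | h, b :: bs => f h * (g (h * val M b) - g h) + II f g (h * val M b) bs

/-- total changes -/
def tc : List (Bl n) → ℤ
  | [] => 0
  | b :: bs => chg b.2 + tc bs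

theorem tc_nonneg (bs : List (Bl n)) : 0 ≤ tc bs := by
  induction bs with
  | nil => exact le_rfl
  | cons b bs ih => have := chg_nonneg b.2; simp only [tc]; omega

theorem wd_cons (b : Bl n) (bs) : wd (b :: bs) = b.2 ++ wd bs := rfl
theorem wd_append (bs cs : List (Bl n)) : wd (bs ++ cs) = wd bs ++ wd cs := by simp [wd]
theorem XF_cons (b : Bl n) (bs) : XF (b :: bs) = ble b.1 b.2 ++ XF bs := rfl
theorem XF_append (bs cs : List (Bl n)) : XF (bs ++ cs) = XF bs ++ XF cs := by simp [XF]

theorem ble_map (q : Finset (Fin n)) (b) : (ble q b).map Ed.l = b := by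
  induction b with
  | nil => rfl
  | cons a s ih =>
    cases s with
    | nil => rfl
    | cons b s => simp [ble, ih]

theorem XF_map (bs : List (Bl n)) : (XF bs).map Ed.l = wd bs := by
  induction bs with
  | nil => rfl
  | cons b bs ih => rw [XF_cons, wd_cons, List.map_append, ble_map, ih]

theorem fg_XF (bs : List (Bl n)) : fg (XF bs) = fw (wd bs) := by rw [fg, XF_map]
theorem fg_ble (q : Finset (Fin n)) (b) : fg (ble q b) = fw b := by rw [fg, ble_map]

theorem ble_ty (q : Finset (Fin n)) (s : List (Fin n × Bool)) :
    ∀ x ∈ ble q s, x.ty = q ∧ x.l ∈ s ∧ 2 ≤ x.o := by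
  induction s with
  | nil => intro x hx; simp [ble] at hx
  | cons a s ih =>
    cases s with
    | nil => intro x hx; simp [ble] at hx; simp [hx]
    | cons b s =>
      intro x hx
      simp only [ble, List.mem_cons] at hx
      rcases hx with rfl | hx
      · simp [ang_ge]
      · have := ih x hx
        exact ⟨this.1, List.mem_cons_of_mem _ this.2.1, this.2.2⟩

theorem ble_sm (q : Finset (Fin n)) (s : List (Fin n × Bool)) (hs : s ≠ []) :
    sm (ble q s) = 3 - chg s := by
  induction s with
  | nil => exact absurd rfl hs
  | cons a s ih =>
    cases s with
    | nil => simp [ble, sm_cons, sm_nil, chg]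
    | cons b s =>
      rw [ble, sm_cons, ih (by simp)]
      simp only [chg, ang_eq]; ring

theorem XF_sm (bs : List (Bl n)) (h : ∀ b ∈ bs, b.2 ≠ []) :
    sm (XF bs) = 3 * bs.length - tc bs := by
  induction bs with
  | nil => simp [XF, sm_nil, tc]
  | cons b bs ih =>
    rw [XF_cons, sm_append, ble_sm _ _ (h b (by simp)), ih (fun c hc => h c (by simp [hc])), tc]
    push_cast [List.length_cons]; ring

theorem ble_flat (q : Finset (Fin n)) (s : List (Fin n × Bool)) :
    ∀ α e β f γ, ble q s = α ++ e :: (β ++ f :: γ) → (e.o - 3) + sm β ≤ 0 := by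
  have key : ∀ (s : List (Fin n × Bool)) α f γ, ble q s = α ++ f :: γ → sm α ≤ 0 := by
    intro s
    induction s with
    | nil => intro α f γ h; simp [ble] at h
    | cons a s ih =>
      cases s with
      | nil =>
        intro α f γ h
        cases α with
        | nil => simp [sm_nil]
        | cons c α => simp [ble] at h
      | cons b s =>
        intro α f γ h
        cases α with
        | nil => simp [sm_nil]
        | cons c α =>
          simp only [ble, List.cons_append, List.cons.injEq] at h
          rw [sm_cons, ← h.1]
          have := ih α f γ h.2
          have := ang_le a.1 b.1
          simp only; omega
  induction s with
  | nil => intro α e β f γ h; simp [ble] at h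
  | cons a s ih =>
    intro α e β f γ h
    cases α with
    | nil =>
      have := key (a :: s) (e :: β) f γ (by simpa using h)
      rwa [sm_cons] at this
    | cons c α =>
      cases s with
      | nil => simp [ble] at h
      | cons b s =>
        simp only [ble, List.cons_append, List.cons.injEq] at h
        exact ih α e β f γ h.2

theorem ble_chain (q : Finset (Fin n)) (s : List (Fin n × Bool)) (hred : FreeGroup.IsReduced s) :
    (ble q s).IsChain (fun e f => Vok e e.o f) := by
  induction s with
  | nil => simp [ble]
  | cons a s ih =>
    cases s with
    | nil => simp [ble]
    | cons b s =>
      have h1 := ih (List.isChain_cons_cons.1 hred).2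
      have h2 := (red_iff _ _).1 (List.isChain_cons_cons.1 hred).1
      cases s with
      | nil =>
        simp only [ble, List.isChain_cons_cons, List.isChain_singleton, and_true]
        exact Or.inl ⟨rfl, le_rfl, h2⟩
      | cons c s =>
        simp only [ble, List.isChain_cons_cons] at h1 ⊢
        exact ⟨Or.inl ⟨rfl, le_rfl, h2⟩, h1⟩

theorem ble_last (q : Finset (Fin n)) (s : List (Fin n × Bool)) :
    ∀ x ∈ (ble q s).getLast?, x.o = 6 := by
  induction s with
  | nil => simp [ble]
  | cons a s ih =>
    cases s with
    | nil => simp [ble]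
    | cons b s =>
      cases s with
      | nil => simp [ble]
      | cons c s =>
        intro x hx
        apply ih
        simpa [ble, List.getLast?_cons_cons] using hx

theorem XF_chain (bs : List (Bl n)) (h : ∀ b ∈ bs, FreeGroup.IsReduced b.2) :
    (XF bs).IsChain (fun e f => Vok e e.o f) := by
  induction bs with
  | nil => simp [XF]
  | cons b bs ih =>
    rw [XF_cons, List.isChain_append]
    refine ⟨ble_chain _ _ (h b (by simp)), ih (fun c hc => h c (by simp [hc])), ?_⟩
    intro x hx y _
    right; left
    exact (ble_last _ _ x hx).ge

theorem XF_loc (bs : List (Bl n)) : ∀ α e β, XF bs = α ++ e :: β →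
    ∃ bs1 b bs2 A B, bs = bs1 ++ b :: bs2 ∧ ble b.1 b.2 = A ++ e :: B ∧ α = XF bs1 ++ A ∧
      β = B ++ XF bs2 := by
  induction bs with
  | nil => intro α e β h; simp [XF] at h
  | cons b bs ih =>
    intro α e β h
    rw [XF_cons] at h
    rcases split_lem h with ⟨B, h1, h2⟩ | ⟨a, h1, h2⟩
    · exact ⟨[], b, bs, α, B, rfl, h1, by simp [XF], h2⟩
    · obtain ⟨bs1, c, bs2, A, B, e1, e2, e3, e4⟩ := ih a e β h2
      exact ⟨b :: bs1, c, bs2, A, B, by simp [e1], e2, by rw [h1, e3, XF_cons, List.append_assoc],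
        e4⟩

/-- relation between block paths -/
def Rl (M : Fin n → Fin n → ℕ∞) (bs cs : List (Bl n)) : Prop :=
  List.Forall₂ (fun b c : Bl n => Ok M c ∧ b.1 = c.1 ∧ val M b = val M c) bs cs

/-- separation -/
def Sp (M : Fin n → Fin n → ℕ∞) (bs : List (Bl n)) : Prop :=
  ∀ α b β c γ, bs = α ++ b :: (β ++ c :: γ) → b.1 = c.1 → FinQ M b.1 →
    artinMk n M (fw (wd β)) ∉ HH n M b.1

theorem Rl_refl {bs : List (Bl n)} (h : ∀ b ∈ bs, Ok M b) : Rl M bs bs := by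
  apply List.forall₂_same.2
  intro b hb
  exact ⟨h b hb, rfl, rfl⟩

theorem Ok.fin {b : Bl n} (h : Ok M b) (hc : b.1.card = 2) :
    FinQ M b.1 ∧ ∀ l ∈ b.2, l.1 ∈ b.1 := by
  rcases h with h | ⟨l, rfl⟩
  · exact h
  · simp at hc

theorem inv_start {bs : List (Bl n)} {k : ℕ} (hok : ∀ b ∈ bs, Ok M b)
    (hred : ∀ b ∈ bs, FreeGroup.IsReduced b.2) (hsp : Sp M bs)
    (hmin : ∀ cs, Rl M bs cs → ∀ j, Ar n M j (fw (wd cs)) → k ≤ j) :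
    Inv n M k 6 (XF bs) := by
  have hmem : ∀ x ∈ XF bs, ∃ b ∈ bs, x ∈ ble b.1 b.2 := by
    intro x hx
    simp only [XF, List.mem_flatten, List.mem_map] at hx
    obtain ⟨l, ⟨b, hb, rfl⟩, hx⟩ := hx
    exact ⟨b, hb, hx⟩
  constructor
  · intro j hj
    rw [fg_XF] at hj
    exact hmin bs (Rl_refl hok) j hj
  · intro x hx
    obtain ⟨b, hb, hx⟩ := hmem x hx
    obtain ⟨h1, h2, h3⟩ := ble_ty _ _ x hx
    rcases hok b hb with h | ⟨l, rfl⟩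
    · rw [h1]; exact ⟨h.2 _ h2, h.1.1.le⟩
    · rw [h1]; simp at h2; simp [h2]
  · exact XF_chain bs hred
  · intro α a b β h1 h2
    right; left
    obtain ⟨c, hb, hx⟩ := hmem a (by rw [h1]; simp)
    have := (ble_ty _ _ a hx).2.2
    omega
  · intro; exact le_rfl
  · intro α e β h1 hc ρ hρ j hj
    obtain ⟨bs1, b, bs2, A, B, rfl, e2, rfl, rfl⟩ := XF_loc bs α e β h1
    have hty : e.ty = b.1 := (ble_ty _ _ e (by rw [e2]; simp)).1
    rw [hty] at hc hρ
    have hb := (hok b (by simp)).fin hc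
    obtain ⟨r, hr, rfl⟩ := mem_closure_iff.1 hρ.1
    have hbw : b.2 = A.map Ed.l ++ (e :: B).map Ed.l := by
      rw [← ble_map b.1 b.2, e2, List.map_append]
    have hone : artinMk n M (fw r) = 1 := Nq_le_ker _ hρ.2
    have hrl : Rl M (bs1 ++ b :: bs2)
        (bs1 ++ (b.1, A.map Ed.l ++ (r ++ (e :: B).map Ed.l)) :: bs2) := by
      refine List.rel_append (R := _) (Rl_refl (fun c hc => hok c (by simp [hc]))) ?_
      refine List.Forall₂.cons ⟨?_, rfl, ?_⟩ (Rl_refl (fun c hc => hok c (by simp [hc])))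
      · left
        refine ⟨hb.1, ?_⟩
        intro l hl
        rw [List.mem_append, List.mem_append] at hl
        rcases hl with hl | hl | hl
        · exact hb.2 l (by rw [hbw]; exact List.mem_append_left _ hl)
        · exact hr l hl
        · exact hb.2 l (by rw [hbw]; exact List.mem_append_right _ hl)
      · simp only [val]
        rw [hbw]; simp only [fw_append, map_mul, hone, one_mul]
    refine hmin _ hrl j ?_
    convert hj using 1
    rw [fg_append, fg_XF, ← List.cons_append, fg_append, fg_XF, wd_append, wd_cons]
    simp only [fw_append, mul_assoc, fg]
    rfl
  · intro α e β f γ h1 hty hc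
    obtain ⟨bs1, b, bs2, A, B, rfl, e2, rfl, e4⟩ := XF_loc bs α e _ h1
    rcases split_lem e4.symm with ⟨B', h2, -⟩ | ⟨a, h2, h3⟩
    · right; right
      exact ble_flat b.1 b.2 A e β f B' (by rw [e2, h2])
    · left
      obtain ⟨bs3, c, bs4, A', B', rfl, f2, rfl, -⟩ := XF_loc bs2 a f γ h3
      have t1 : e.ty = b.1 := (ble_ty _ _ e (by rw [e2]; simp)).1
      have t2 : f.ty = c.1 := (ble_ty _ _ f (by rw [f2]; simp)).1
      have hb := (hok b (by simp)).fin (by rw [← t1]; exact hc)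
      have hcc := (hok c (by simp)).fin (by rw [← t2, ← hty]; exact hc)
      have hs := hsp bs1 b bs3 c bs4 rfl (by rw [← t1, ← t2, hty]) hb.1
      intro h1'
      apply hs
      have m1 : artinMk n M (fg (e :: B)) ∈ HH n M b.1 := by
        apply HH_word
        intro l hl
        apply hb.2
        rw [← ble_map b.1 b.2, e2, List.map_append]
        exact List.mem_append_right _ hl
      have m2 : artinMk n M (fg (A' ++ [f])) ∈ HH n M b.1 := by
        apply HH_word
        intro l hl
        rw [← t1, hty, t2]
        apply hcc.2
        rw [← ble_map c.1 c.2, f2]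
        have : A' ++ f :: B' = (A' ++ [f]) ++ B' := by simp
        rw [this, List.map_append]
        exact List.mem_append_left _ hl
      have e1 : e :: (β ++ [f]) = (e :: B) ++ (XF bs3 ++ (A' ++ [f])) := by rw [h2]; simp
      rw [e1, fg_append, fg_append, map_mul, map_mul, fg_XF] at h1'
      have : artinMk n M (fw (wd bs3)) =
          (artinMk n M (fg (e :: B)))⁻¹ * (artinMk n M (fg (A' ++ [f])))⁻¹ := by
        rw [eq_mul_inv_iff_mul_eq]
        exact eq_inv_of_mul_eq_one_right h1'
      rw [this]
      exact Subgroup.mul_mem _ (Subgroup.inv_mem _ m1) (Subgroup.inv_mem _ m2)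

end
end VK

namespace VK
section
variable {n : ℕ} {M : Fin n → Fin n → ℕ∞}

theorem J_II {f g : GA n M → ℝ} (hf : Lip f) (hg : Lip g) (bs : List (Bl n))
    (hok : ∀ b ∈ bs, Ok M b) (h : GA n M) :
    |J (om f g) h (wd bs) - II f g h bs| ≤ tc bs + bs.length := by
  induction bs generalizing h with
  | nil => simp [wd, J, II, tc]
  | cons b bs ih =>
    have h1 := ih (fun c hc => hok c (by simp [hc])) (h * val M b)
    have h2 : |J (om f g) h b.2 - f h * (g (h * val M b) - g h)| ≤ chg b.2 + 1 := by
      rcases hok b (by simp) with hb | ⟨l, rfl⟩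
      · exact block_est hb.1 hf hg b.2 hb.2 h
      · have := single_est hf hg l h
        simpa [chg, val] using this
    have h3 := abs_add_le _ _ |>.trans (add_le_add h1 h2)
    rw [wd_cons, J_append, II, tc]
    push_cast [List.length_cons]
    refine le_trans (le_of_eq ?_) (h3.trans (le_of_eq (by ring)))
    rw [val]
    congr 1; ring

variable (M) in
/-- signature -/
def sig (b : Bl n) : Finset (Fin n) × GA n M := (b.1, val M b)

theorem Rl_iff (bs cs : List (Bl n)) :
    Rl M bs cs ↔ (∀ c ∈ cs, Ok M c) ∧ bs.map (sig M) = cs.map (sig M) := by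
  unfold Rl
  induction bs generalizing cs with
  | nil =>
    cases cs with
    | nil => simp
    | cons c cs => simp
  | cons b bs ih =>
    cases cs with
    | nil => simp
    | cons c cs =>
      simp only [List.forall₂_cons, ih, List.mem_cons, forall_eq_or_imp, List.map_cons,
        List.cons.injEq, sig, Prod.mk.injEq]
      tauto

theorem wd_sig (bs : List (Bl n)) :
    artinMk n M (fw (wd bs)) = ((bs.map (sig M)).map Prod.snd).prod := by
  induction bs with
  | nil => simp [wd, fw_nil]
  | cons b bs ih =>
    rw [wd_cons, fw_append, map_mul, ih]; simp [sig, val]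

theorem II_sig (f g : GA n M → ℝ) (bs : List (Bl n)) :
    ∀ (cs : List (Bl n)) (h : GA n M), bs.map (sig M) = cs.map (sig M) →
      II f g h bs = II f g h cs := by
  induction bs with
  | nil =>
    intro cs h hh
    cases cs with
    | nil => rfl
    | cons c cs => simp at hh
  | cons b bs ih =>
    intro cs h hh
    cases cs with
    | nil => simp at hh
    | cons c cs =>
      simp only [List.map_cons, List.cons.injEq, sig, Prod.mk.injEq] at hh
      rw [II, II, hh.1.2, ih cs _ hh.2]

theorem Sp_sig {bs cs : List (Bl n)} (h : bs.map (sig M) = cs.map (sig M)) (hs : Sp M bs) :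
    Sp M cs := by
  intro α b β c γ e1 hbc hb
  rw [e1, List.map_append, List.map_cons, List.map_append, List.map_cons] at h
  obtain ⟨α', r1, rfl, -, h⟩ := List.map_eq_append_iff.1 h
  obtain ⟨b', r2, rfl, hb', h⟩ := List.map_eq_cons_iff.1 h
  obtain ⟨β', r3, rfl, hβ, h⟩ := List.map_eq_append_iff.1 h
  obtain ⟨c', γ', rfl, hc', h⟩ := List.map_eq_cons_iff.1 h
  have b1 : b'.1 = b.1 := congrArg (fun z : Finset (Fin n) × GA n M => z.1) hb'
  have c1 : c'.1 = c.1 := congrArg (fun z : Finset (Fin n) × GA n M => z.1) hc'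
  have := hs α' b' β' c' γ' rfl (by rw [b1, c1, hbc]) (by rw [b1]; exact hb)
  rwa [wd_sig, hβ, ← wd_sig, b1] at this

theorem caseC (hsym : ∀ i j, M i j = M j i) (hM : ∀ i j, i ≠ j → 7 ≤ M i j)
    {f g : GA n M → ℝ} (hf : Lip f) (hg : Lip g) (bs : List (Bl n))
    (hok : ∀ b ∈ bs, Ok M b) (hne : ∀ b ∈ bs, val M b ≠ 1) (hsp : Sp M bs)
    (hcl : artinMk n M (fw (wd bs)) = 1) (h : GA n M) :
    |II f g h bs| ≤ 25 * bs.length := by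
  classical
  have hex : ∃ k, ∃ cs, Rl M bs cs ∧ Ar n M k (fw (wd cs)) := by
    obtain ⟨k, hk⟩ := ker_area hcl
    exact ⟨k, bs, Rl_refl hok, hk⟩
  obtain ⟨cs, h1, h2⟩ := Nat.find_spec hex
  have hmin := fun k hk => Nat.find_min' (m := k) hex hk
  set k := Nat.find hex with hk
  rw [Rl_iff] at h1
  set ds : List (Bl n) := cs.map (fun b => (b.1, FreeGroup.reduce b.2)) with hds
  have hred0 : ∀ w : List (Fin n × Bool), fw (FreeGroup.reduce w) = fw w := fun w =>
    FreeGroup.reduce.self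
  have d1 : ∀ b ∈ ds, Ok M b := by
    intro b hb
    rw [hds, List.mem_map] at hb
    obtain ⟨c, hc, rfl⟩ := hb
    rcases h1.1 c hc with h | ⟨l, rfl⟩
    · exact Or.inl ⟨h.1, reduce_mem h.2⟩
    · right; exact ⟨l, by simp⟩
  have d2 : cs.map (sig M) = ds.map (sig M) := by
    rw [hds, List.map_map]
    apply List.map_congr_left
    intro c _
    simp [sig, val, hred0]
  have d3 : fw (wd ds) = fw (wd cs) := by
    rw [hds]
    clear * - hred0
    induction cs with
    | nil => rfl
    | cons c cs ih => rw [List.map_cons, wd_cons, wd_cons, fw_append, fw_append, ih, hred0]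
  have d4 : ∀ b ∈ ds, FreeGroup.IsReduced b.2 := by
    intro b hb
    rw [hds, List.mem_map] at hb
    obtain ⟨c, hc, rfl⟩ := hb
    exact FreeGroup.isReduced_iff_reduce_eq.2 FreeGroup.reduce.idem
  have hbd : bs.map (sig M) = ds.map (sig M) := h1.2.trans d2
  have d5 : ∀ b ∈ ds, b.2 ≠ [] := by
    intro b hb hn
    have : sig M b ∈ bs.map (sig M) := by rw [hbd]; exact List.mem_map_of_mem hb
    obtain ⟨c, hc, hcb⟩ := List.mem_map.1 this
    apply hne c hc
    have := congrArg Prod.snd hcb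
    simp only [sig] at this
    rw [this, val, hn, fw_nil, map_one]
  have hlen : bs.length = ds.length := by
    have := congrArg List.length hbd
    simpa using this
  have hI : Inv n M k 6 (XF ds) := by
    refine inv_start d1 d4 (Sp_sig hbd hsp) ?_
    intro es hes j hj
    rw [Rl_iff] at hes
    exact hmin j ⟨es, (Rl_iff _ _).2 ⟨hes.1, hbd.trans hes.2⟩, hj⟩
  rw [← d3] at h2
  obtain ⟨j, hj, hD⟩ := (area_iff RR_rot).1 h2
  have hkj : k ≤ j := by
    apply hmin j
    refine ⟨ds, (Rl_iff _ _).2 ⟨d1, hbd⟩, ?_⟩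
    exact ⟨_, j, le_rfl, rfl, hD⟩
  have hjk : j = k := by omega
  rw [hjk] at hD
  obtain ⟨-, m2⟩ := main_curv hsym hM (om f g) 8 (by norm_num) (om_anti f g)
    (rel_est hsym hM hf hg) hD 6 (XF ds) (XF_map ds) hI
  have m3 := m2 h
  rw [XF_sm ds d5] at m3
  have m4 := J_II hf hg ds d1 h
  rw [II_sig f g bs ds h hbd, hlen]
  have m5 : (0 : ℝ) ≤ tc ds := by exact_mod_cast tc_nonneg ds
  have m6 := abs_sub_abs_le_abs_sub (II f g h ds) (J (om f g) h (wd ds))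
  rw [abs_sub_comm] at m6
  push_cast at m3
  linarith

theorem II_append (f g : GA n M → ℝ) (bs cs : List (Bl n)) (h : GA n M) :
    II f g h (bs ++ cs) = II f g h bs + II f g (h * artinMk n M (fw (wd bs))) cs := by
  induction bs generalizing h with
  | nil => simp [II, wd, fw_nil]
  | cons b bs ih =>
    rw [List.cons_append, II, II, ih, wd_cons, fw_append, map_mul, ← mul_assoc, add_assoc]
    rfl

theorem star (hsym : ∀ i j, M i j = M j i) (hM : ∀ i j, i ≠ j → 7 ≤ M i j)
    {f g : GA n M → ℝ} (hf : Lip f) (hg : Lip g) (L : ℕ) : ∀ (bs : List (Bl n)),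
    bs.length = L → (∀ b ∈ bs, Ok M b) → artinMk n M (fw (wd bs)) = 1 → ∀ h : GA n M,
    1 ≤ L → |II f g h bs| ≤ 26 * L - 1 := by
  induction L using Nat.strong_induction_on with
  | _ L IH =>
    intro bs hL hok hcl h hL1
    by_cases hA : ∃ b ∈ bs, val M b = 1
    · obtain ⟨b, hb, hv⟩ := hA
      obtain ⟨α, β, rfl⟩ := List.append_of_mem hb
      have e1 : II f g h (α ++ b :: β) = II f g h (α ++ β) := by
        rw [II_append, II_append, II, hv]; simp
      rw [e1]
      by_cases hz : (α ++ β) = []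
      · rw [hz]
        have : (1 : ℝ) ≤ L := by exact_mod_cast hL1
        simp only [II, abs_zero]; linarith
      · have hlen : (α ++ β).length = L - 1 := by simp at hL ⊢; omega
        have hpos : 1 ≤ (α ++ β).length := List.length_pos_iff.2 hz
        have := IH (L - 1) (by omega) (α ++ β) hlen (fun c hc => hok c (by simp at hc ⊢; tauto))
          (by
            rw [wd_append, wd_cons, fw_append, fw_append, map_mul, map_mul] at hcl
            have hv' : artinMk n M (fw b.2) = 1 := hv
            rw [hv', one_mul] at hcl
            rw [wd_append, fw_append, map_mul, hcl]) h (by omega)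
        have hc : ((L - 1 : ℕ) : ℝ) = L - 1 := by push_cast [hL1]; ring
        rw [hc] at this
        linarith
    · by_cases hB : Sp M bs
      · have := caseC hsym hM hf hg bs hok (fun b hb h => hA ⟨b, hb, h⟩) hB hcl h
        rw [hL] at this
        have h1 : (1 : ℝ) ≤ L := by exact_mod_cast hL1
        linarith
      · unfold Sp at hB
        push Not at hB
        obtain ⟨α, b, β, c, γ, rfl, hbc, hq, hH⟩ := hB
        have hb := (hok b (by simp)).fin hq.1
        have hc := (hok c (by simp)).fin (by rw [← hbc]; exact hq.1)
        obtain ⟨x, hx, hxv⟩ := HH_exists hH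
        obtain ⟨y, hy, hyv⟩ := HH_exists (Subgroup.inv_mem _ hH)
        simp only [List.length_append, List.length_cons] at hL
        set vβ := artinMk n M (fw (wd β)) with hvβ
        have l1 := IH (β.length + 1) (by omega) (β ++ [(b.1, y)]) (by simp)
          (by
            intro d hd
            rw [List.mem_append, List.mem_singleton] at hd
            rcases hd with hd | rfl
            · exact hok d (by simp [hd])
            · exact Or.inl ⟨hq, hy⟩)
          (by
            rw [wd_append, fw_append, map_mul, ← hvβ]
            simp [wd, hyv])
          (h * artinMk n M (fw (wd α)) * val M b) (by omega)
        have hmerge : artinMk n M (fw (b.2 ++ (x ++ c.2))) = val M b * vβ * val M c := by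
          rw [fw_append, fw_append, map_mul, map_mul, hxv, ← mul_assoc]; rfl
        have l2 := IH (α.length + γ.length + 1) (by omega)
          (α ++ (b.1, b.2 ++ (x ++ c.2)) :: γ) (by simp; omega)
          (by
            intro d hd
            rw [List.mem_append, List.mem_cons] at hd
            rcases hd with hd | rfl | hd
            · exact hok d (by simp [hd])
            · left
              refine ⟨hq, ?_⟩
              intro l hl
              simp only [List.mem_append] at hl
              rcases hl with hl | hl | hl
              · exact hb.2 l hl
              · exact hx l hl
              · have := hc.2 l hl; rwa [← hbc] at this
            · exact hok d (by simp [hd]))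
          (by
            rw [← hcl]
            simp only [wd_append, wd_cons, fw_append, map_mul, hxv, mul_assoc, hvβ])
          h (by omega)
        rw [II_append, II, II_append, II]
        rw [II_append, II, II] at l1
        rw [II_append, II] at l2
        have v1 : val M (b.1, y) = vβ⁻¹ := hyv
        have v2 : val M (b.1, b.2 ++ (x ++ c.2)) = val M b * vβ * val M c := hmerge
        rw [v1, ← hvβ] at l1
        rw [v2] at l2
        rw [← hvβ]
        set h0 := h * artinMk n M (fw (wd α)) with hh0
        simp only [← mul_assoc] at l2
        rw [mul_inv_cancel_right] at l1
        set h1 := h0 * val M b with hh1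
        set h2 := h1 * vβ with hh2
        set h3 := h2 * val M c with hh3
        have q1 : |f h2 - f h0| ≤ 1 := by
          have := hf h0 (val M b * vβ) (Or.inl ⟨b.1, hq, Subgroup.mul_mem _ (HH_word hb.2) hH⟩)
          rwa [← mul_assoc] at this
        have q2 : |g h3 - g h1| ≤ 1 := by
          have := hg h1 (vβ * val M c) (Or.inl ⟨b.1, hq, Subgroup.mul_mem _ hH
            (by rw [hbc]; exact HH_word hc.2)⟩)
          rwa [← mul_assoc] at this
        have q3 := mul_le_mul q1 q2 (abs_nonneg _) zero_le_one
        rw [← abs_mul] at q3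
        have q4 := abs_add_le _ _ |>.trans (add_le_add (abs_add_le _ _ |>.trans (add_le_add l1 l2)) q3)
        have hLr : (L : ℝ) = α.length + (β.length + 1 + (γ.length + 1)) := by
          rw [← hL]; push_cast; ring
        push_cast at q4
        refine le_trans (le_of_eq ?_) (q4.trans ?_)
        · congr 1; ring
        · rw [hLr]; linarith

end
end VK

namespace VK
section
variable {V : Type} (Γ : SimpleGraph V)

/-- Lipschitz on a graph -/
def GLip (f : V → ℝ) : Prop := ∀ u v, Γ.Adj u v → |f v - f u| ≤ 1

/-- linear isoperimetric inequality -/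
def Iso (K : ℕ) : Prop := ∀ f g : V → ℝ, GLip Γ f → GLip Γ g → ∀ (p : ℕ → V) (L : ℕ),
  (∀ t < L, Γ.Adj (p t) (p (t + 1))) → p 0 = p L →
  |∑ t ∈ Finset.range L, f (p t) * (g (p (t + 1)) - g (p t))| ≤ K * L

/-- geodesic -/
def Geo (γ : ℕ → V) (N : ℕ) : Prop := ∀ i j, i ≤ j → j ≤ N → i + Γ.dist (γ i) (γ j) = j

variable {Γ}

theorem Geo.adj {γ : ℕ → V} {N : ℕ} (h : Geo Γ γ N) {t : ℕ} (ht : t < N) :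
    Γ.Adj (γ t) (γ (t + 1)) := by
  have := h t (t + 1) (by omega) (by omega)
  exact SimpleGraph.dist_eq_one_iff_adj.1 (by omega)

theorem Geo.shift {γ : ℕ → V} {N : ℕ} (h : Geo Γ γ N) {a m : ℕ} (hm : a + m ≤ N) :
    Geo Γ (fun t => γ (a + t)) m := by
  intro i j hij hj
  have := h (a + i) (a + j) (by omega) (by omega)
  simp only; omega

theorem Geo.rev {γ : ℕ → V} {N : ℕ} (h : Geo Γ γ N) {a : ℕ} (ha : a ≤ N) :
    Geo Γ (fun t => γ (a - t)) a := by
  intro i j hij hj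
  have := h (a - j) (a - i) (by omega) (by omega)
  simp only; rw [SimpleGraph.dist_comm]; omega

theorem exists_geo (hc : Γ.Connected) (x y : V) :
    ∃ γ : ℕ → V, γ 0 = x ∧ γ (Γ.dist x y) = y ∧ Geo Γ γ (Γ.dist x y) := by
  obtain ⟨W, hW⟩ := hc.exists_walk_length_eq_dist x y
  refine ⟨W.getVert, W.getVert_zero, by rw [← hW]; exact W.getVert_length, ?_⟩
  have key : ∀ i j, i ≤ j → j ≤ W.length → Γ.dist (W.getVert i) (W.getVert j) ≤ j - i := by
    intro i j hij
    induction j, hij using Nat.le_induction with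
    | base => intro _; simp
    | succ j hij ih =>
      intro hj
      have h1 := ih (by omega)
      have h2 : Γ.dist (W.getVert j) (W.getVert (j + 1)) = 1 :=
        SimpleGraph.dist_eq_one_iff_adj.2 (W.adj_getVert_succ (by omega))
      have h3 := hc.dist_triangle (u := W.getVert i) (v := W.getVert j) (w := W.getVert (j + 1))
      omega
  intro i j hij hj
  rw [← hW] at hj
  have h1 := key 0 i (by omega) (by omega)
  have h2 := key i j hij hj
  have h3 := key j W.length hj le_rfl
  rw [W.getVert_zero] at h1
  rw [W.getVert_length] at h3
  have h4 := hc.dist_triangle (u := x) (v := W.getVert i) (w := y)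
  have h5 := hc.dist_triangle (u := W.getVert i) (v := W.getVert j) (w := y)
  omega

theorem area_lem (hc : Γ.Connected) {K : ℕ} (hK : Iso Γ K) {σ : ℕ → V} {m : ℕ} (hσ : Geo Γ σ m)
    (W : Γ.Walk (σ m) (σ 0)) {a b r : ℕ} (hab : a ≤ b) (hb : b ≤ m)
    (hfar : ∀ t, a ≤ t → t < b → ∀ w ∈ W.support, r ≤ Γ.dist (σ t) w) :
    (b - a) * r ≤ K * (m + W.length) := by
  set F : V → ℕ := fun v => sInf (Γ.dist v '' {w | w ∈ W.support}) with hF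
  have hne : ∀ v, (Γ.dist v '' {w | w ∈ W.support}).Nonempty := fun v =>
    ⟨_, _, W.start_mem_support, rfl⟩
  have hF0 : ∀ w ∈ W.support, F w = 0 := by
    intro w hw
    exact Nat.le_zero.1 (Nat.sInf_le ⟨w, hw, by simp⟩)
  have hFl : ∀ u v, Γ.Adj u v → F u ≤ F v + 1 := by
    intro u v huv
    obtain ⟨w, hw, hw2⟩ := Nat.sInf_mem (hne v)
    have h1 : F u ≤ Γ.dist u w := Nat.sInf_le ⟨w, hw, rfl⟩
    have h2 : Γ.dist u v = 1 := SimpleGraph.dist_eq_one_iff_adj.2 huv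
    have h3 := hc.dist_triangle (u := u) (v := v) (w := w)
    have : F v = Γ.dist v w := hw2.symm
    omega
  have hFr : ∀ t, a ≤ t → t < b → r ≤ F (σ t) := by
    intro t h1 h2
    obtain ⟨w, hw, hw2⟩ := Nat.sInf_mem (hne (σ t))
    have : F (σ t) = Γ.dist (σ t) w := hw2.symm
    rw [this]; exact hfar t h1 h2 w hw
  have fl : GLip Γ (fun v => (F v : ℝ)) := by
    intro u v huv
    have h1 : (F u : ℝ) ≤ F v + 1 := by exact_mod_cast hFl u v huv
    have h2 : (F v : ℝ) ≤ F u + 1 := by exact_mod_cast hFl v u huv.symm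
    rw [abs_le]; constructor <;> simp only <;> linarith
  have gl : GLip Γ (fun v => (Γ.dist (σ 0) v : ℝ)) := by
    intro u v huv
    have h0 : Γ.dist u v = 1 := SimpleGraph.dist_eq_one_iff_adj.2 huv
    have h0' : Γ.dist v u = 1 := SimpleGraph.dist_eq_one_iff_adj.2 huv.symm
    have h1 := hc.dist_triangle (u := σ 0) (v := u) (w := v)
    have h2 := hc.dist_triangle (u := σ 0) (v := v) (w := u)
    rw [h0] at h1
    rw [h0'] at h2
    have h1' : (Γ.dist (σ 0) v : ℝ) ≤ Γ.dist (σ 0) u + 1 := by exact_mod_cast h1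
    have h2' : (Γ.dist (σ 0) u : ℝ) ≤ Γ.dist (σ 0) v + 1 := by exact_mod_cast h2
    rw [abs_le]; constructor <;> simp only <;> linarith
  set p : ℕ → V := fun t => if t ≤ m then σ t else W.getVert (t - m) with hp
  have p1 : ∀ t ≤ m, p t = σ t := fun t ht => by simp [hp, ht]
  have p2 : ∀ t, p (m + t) = W.getVert t := by
    intro t
    cases t with
    | zero => simp [hp]
    | succ t => simp [hp]
  have key := hK _ _ fl gl p (m + W.length)
    (by
      intro t ht
      by_cases htm : t < m
      · rw [p1 t (by omega), p1 (t + 1) (by omega)]; exact hσ.adj htm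
      · obtain ⟨s, rfl⟩ := Nat.exists_eq_add_of_le (not_lt.1 htm)
        rw [add_assoc, p2, p2]
        exact W.adj_getVert_succ (by omega))
    (by rw [p1 0 (by omega), p2, W.getVert_length])
  rw [Finset.sum_range_add] at key
  have s2 : ∑ x ∈ Finset.range W.length, (F (p (m + x)) : ℝ) *
      ((Γ.dist (σ 0) (p (m + x + 1)) : ℝ) - Γ.dist (σ 0) (p (m + x))) = 0 := by
    apply Finset.sum_eq_zero
    intro x _
    rw [p2, hF0 _ (W.getVert_mem_support x)]; simp
  have s1 : ∑ x ∈ Finset.range m, (F (p x) : ℝ) *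
      ((Γ.dist (σ 0) (p (x + 1)) : ℝ) - Γ.dist (σ 0) (p x)) = ∑ x ∈ Finset.range m, (F (σ x) : ℝ) := by
    apply Finset.sum_congr rfl
    intro x hx
    rw [Finset.mem_range] at hx
    rw [p1 x (by omega), p1 (x + 1) (by omega)]
    have h1 := hσ 0 x (by omega) (by omega)
    have h2 := hσ 0 (x + 1) (by omega) (by omega)
    rw [zero_add] at h1 h2
    rw [h1, h2]; push_cast; ring
  have s3 : ((b - a : ℕ) : ℝ) * r ≤ ∑ x ∈ Finset.range m, (F (σ x) : ℝ) := by
    calc ((b - a : ℕ) : ℝ) * r = ∑ x ∈ Finset.Ico a b, (r : ℝ) := by simp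
      _ ≤ ∑ x ∈ Finset.Ico a b, (F (σ x) : ℝ) := by
        apply Finset.sum_le_sum
        intro x hx
        rw [Finset.mem_Ico] at hx
        exact_mod_cast hFr x hx.1 hx.2
      _ ≤ _ := by
        apply Finset.sum_le_sum_of_subset_of_nonneg
        · intro x hx
          rw [Finset.mem_Ico] at hx
          rw [Finset.mem_range]; omega
        · intros; positivity
  rw [s1, s2, add_zero] at key
  have := s3.trans ((le_abs_self _).trans key)
  exact_mod_cast this

/-- reachability within a region -/
def Rch (Γ : SimpleGraph V) (P : V → Prop) (l : ℕ) (u v : V) : Prop :=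
  ∃ W : Γ.Walk u v, W.length ≤ l ∧ ∀ w ∈ W.support, P w

theorem Rch.trans {P : V → Prop} {l l' : ℕ} {u v w : V} (h : Rch Γ P l u v) (h' : Rch Γ P l' v w) :
    Rch Γ P (l + l') u w := by
  obtain ⟨W, h1, h2⟩ := h
  obtain ⟨W', h1', h2'⟩ := h'
  refine ⟨W.append W', by rw [SimpleGraph.Walk.length_append]; omega, ?_⟩
  intro x hx
  rw [SimpleGraph.Walk.mem_support_append_iff] at hx
  exact hx.elim (h2 x) (h2' x)

theorem Rch.symm {P : V → Prop} {l : ℕ} {u v : V} (h : Rch Γ P l u v) : Rch Γ P l v u := by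
  obtain ⟨W, h1, h2⟩ := h
  refine ⟨W.reverse, by rw [SimpleGraph.Walk.length_reverse]; exact h1, ?_⟩
  intro x hx
  rw [SimpleGraph.Walk.support_reverse, List.mem_reverse] at hx
  exact h2 x hx

theorem Rch.mono {P : V → Prop} {l l' : ℕ} {u v : V} (h : Rch Γ P l u v) (hl : l ≤ l') :
    Rch Γ P l' u v := by
  obtain ⟨W, h1, h2⟩ := h
  exact ⟨W, h1.trans hl, h2⟩

theorem Geo.rch {γ : ℕ → V} {N : ℕ} (h : Geo Γ γ N) {P : V → Prop} {i j : ℕ} (hij : i ≤ j)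
    (hj : j ≤ N) (hP : ∀ k, i ≤ k → k ≤ j → P (γ k)) : Rch Γ P (j - i) (γ i) (γ j) := by
  induction j, hij using Nat.le_induction with
  | base => exact ⟨SimpleGraph.Walk.nil, by simp, by simpa using hP i le_rfl le_rfl⟩
  | succ j hij ih =>
    have h1 := ih (by omega) (fun k a b => hP k a (by omega))
    have h2 : Rch Γ P 1 (γ j) (γ (j + 1)) := by
      refine ⟨(h.adj (by omega : j < N)).toWalk, by simp, ?_⟩
      intro w hw
      simp at hw
      rcases hw with rfl | rfl
      · exact hP _ hij (by omega)
      · exact hP _ (by omega) le_rfl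
    exact (h1.trans h2).mono (by omega)

theorem rch_ball (hc : Γ.Connected) {P : V → Prop} {u v : V} {D : ℕ} (hD : Γ.dist u v ≤ D)
    (hP : ∀ w, Γ.dist u w ≤ D → P w) : Rch Γ P D u v := by
  obtain ⟨γ, h0, h1, h2⟩ := exists_geo hc u v
  have := h2.rch (P := P) (Nat.zero_le _) le_rfl (by
    intro k _ hk
    apply hP
    have := h2 0 k (by omega) hk
    rw [h0] at this; omega)
  rw [h0, h1] at this
  exact this.mono (by omega)

end
end VK

namespace VK
section
variable {V : Type} {Γ : SimpleGraph V}

theorem Rch.dist {P : V → Prop} {l : ℕ} {u v : V} (h : Rch Γ P l u v) : Γ.dist u v ≤ l := by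
  obtain ⟨W, h1, _⟩ := h
  exact (SimpleGraph.dist_le W).trans h1

theorem Lp (hc : Γ.Connected) {K : ℕ} (hK : Iso Γ K) {u v ρ : ℕ → V} {A B N D i0 : ℕ}
    (hu : Geo Γ u A) (hv : Geo Γ v B) (hρ : Geo Γ ρ N) (h0 : u 0 = v 0) (hA : ρ 0 = u A)
    (hB : ρ N = v B) (hQ : ∀ i j, i ≤ A → j ≤ B → i + j ≤ 3 * Γ.dist (u i) (v j))
    (hDu : ∀ i ≤ A, ∃ k ≤ N, Γ.dist (u i) (ρ k) ≤ D)
    (hDv : ∀ j ≤ B, ∃ k ≤ N, Γ.dist (v j) (ρ k) ≤ D)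
    (hi0 : i0 ≤ A) (hD : ∀ k ≤ N, D ≤ Γ.dist (u i0) (ρ k)) : D < 24 * (240 * K + 1) := by
  by_contra hbig
  obtain ⟨r, hr⟩ : ∃ r, r = D / 24 := ⟨_, rfl⟩
  have r1 : 24 * r ≤ D := by omega
  have r2 : D < 24 * r + 24 := by omega
  have r3 : 240 * K + 1 ≤ r := by omega
  have tri : ∀ a b c, Γ.dist a c ≤ Γ.dist a b + Γ.dist b c := fun a b c => hc.dist_triangle
  have cm : ∀ a b, Γ.dist a b = Γ.dist b a := fun a b => SimpleGraph.dist_comm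
  have hAi : i0 + D ≤ A := by
    have h1 := hD 0 (by omega)
    rw [hA] at h1
    have h2 := hu i0 A hi0 le_rfl
    omega
  set P : V → Prop := fun w => ∀ t, i0 + 3 * r ≤ t → t < i0 + 9 * r → r ≤ Γ.dist (u t) w with hP
  have Pu1 : ∀ k, i0 + 12 * r ≤ k → k ≤ A → P (u k) := by
    intro k h1 h2 t h3 h4
    have := hu t k (by omega) h2
    omega
  have Pu2 : ∀ k ≤ i0, P (u k) := by
    intro k h1 t h3 h4
    have := hu k t (by omega) (by omega)
    rw [cm] at this; omega
  have Pv : ∀ k ≤ B, P (v k) := by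
    intro k h1 t h3 h4
    have := hQ t k (by omega) h1
    omega
  have Pρ : ∀ k ≤ N, P (ρ k) := by
    intro k h1 t h3 h4
    have e1 := hD k h1
    have e2 := tri (u i0) (u t) (ρ k)
    have e3 := hu i0 t (by omega) (by omega)
    omega
  have ball : ∀ x y, Γ.dist x y ≤ D → (∀ t, i0 + 3 * r ≤ t → t < i0 + 9 * r → D + r ≤ Γ.dist (u t) x)
      → Rch Γ P D x y := by
    intro x y h1 h2
    refine rch_ball hc h1 ?_
    intro w hw t h3 h4
    have e1 := h2 t h3 h4
    have e2 := tri (u t) w x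
    rw [cm w x] at e2
    omega
  have triv : ∀ x, P x → Rch Γ P D x x := fun x hx =>
    ⟨SimpleGraph.Walk.nil, by simp, by simpa using hx⟩
  -- outer side
  obtain ⟨P1, k1, hk1, a1, a2⟩ : ∃ P1, ∃ k1 ≤ N, Rch Γ P (6 * D) (u (i0 + 12 * r)) P1 ∧
      Rch Γ P D P1 (ρ k1) := by
    by_cases hh : A ≤ i0 + 6 * D
    · refine ⟨u A, 0, by omega, ?_, ?_⟩
      · exact (hu.rch (by omega) le_rfl (fun k h1 h2 => Pu1 k h1 h2)).mono (by omega)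
      · rw [hA]; exact triv _ (Pu1 A (by omega) le_rfl)
    · obtain ⟨k, hk, hk2⟩ := hDu (i0 + 6 * D) (by omega)
      refine ⟨u (i0 + 6 * D), k, hk, ?_, ?_⟩
      · exact (hu.rch (by omega) (by omega) (fun k h1 h2 => Pu1 k h1 (by omega))).mono (by omega)
      · refine ball _ _ hk2 ?_
        intro t h1 h2
        have := hu t (i0 + 6 * D) (by omega) (by omega)
        omega
  obtain ⟨P2, k2, hk2, b1, b2⟩ : ∃ P2, ∃ k2 ≤ N, Rch Γ P (6 * D) P2 (u i0) ∧
      Rch Γ P D P2 (ρ k2) := by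
    by_cases h6 : 6 * D ≤ i0
    · obtain ⟨k, hk, hk2⟩ := hDu (i0 - 6 * D) (by omega)
      refine ⟨u (i0 - 6 * D), k, hk, ?_, ?_⟩
      · exact (hu.rch (by omega) hi0 (fun k h1 h2 => Pu2 k h2)).mono (by omega)
      · refine ball _ _ hk2 ?_
        intro t h1 h2
        have := hu (i0 - 6 * D) t (by omega) (by omega)
        rw [cm] at this; omega
    · have c1 : Rch Γ P i0 (u 0) (u i0) :=
        (hu.rch (by omega) hi0 (fun k h1 h2 => Pu2 k h2)).mono (by omega)
      rw [h0] at c1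
      by_cases hh : B ≤ 6 * D - i0
      · refine ⟨v B, N, le_rfl, ?_, ?_⟩
        · exact ((hv.rch (by omega) le_rfl (fun k h1 h2 => Pv k h2)).symm.trans c1).mono (by omega)
        · rw [hB]; exact triv _ (Pv B le_rfl)
      · obtain ⟨k, hk, hk2⟩ := hDv (6 * D - i0) (by omega)
        refine ⟨v (6 * D - i0), k, hk, ?_, ?_⟩
        · exact ((hv.rch (Nat.zero_le _) (by omega) (fun k h1 h2 => Pv k (by omega))).symm.trans
            c1).mono (by omega)
        · refine ball _ _ hk2 ?_
          intro t h1 h2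
          have := hQ t (6 * D - i0) (by omega) (by omega)
          omega
  have d1 : Γ.dist (u (i0 + 12 * r)) (u i0) ≤ 12 * r := by
    have := hu i0 (i0 + 12 * r) (by omega) (by omega)
    rw [cm]; omega
  have dk : Γ.dist (ρ k1) (ρ k2) ≤ 15 * D := by
    have e1 := a1.dist
    have e2 := a2.dist
    have e3 := b1.dist
    have e4 := b2.dist
    have f1 := tri (ρ k1) P1 (ρ k2)
    have f2 := tri P1 (u (i0 + 12 * r)) (ρ k2)
    have f3 := tri (u (i0 + 12 * r)) (u i0) (ρ k2)
    have f4 := tri (u i0) P2 (ρ k2)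
    rw [cm (ρ k1) P1] at f1
    rw [cm P1 (u (i0 + 12 * r))] at f2
    rw [cm (u i0) P2] at f4
    omega
  have c3 : Rch Γ P (15 * D) (ρ k1) (ρ k2) := by
    rcases le_total k1 k2 with h | h
    · have := hρ k1 k2 h hk2
      exact (hρ.rch h hk2 (fun k _ h2 => Pρ k (by omega))).mono (by omega)
    · have := hρ k2 k1 h hk1
      rw [cm] at this
      exact (hρ.rch h hk1 (fun k _ h2 => Pρ k (by omega))).symm.mono (by omega)
  obtain ⟨W, hW1, hW2⟩ := (((a1.trans a2).trans c3).trans b2.symm).trans b1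
  have hσ := hu.shift (a := i0) (m := 12 * r) (by omega)
  have key := area_lem hc hK hσ W (a := 3 * r) (b := 9 * r) (r := r) (by omega) (by omega) (by
    intro t h1 h2 w hw
    exact hW2 w hw (i0 + t) (by omega) (by omega))
  have e : 9 * r - 3 * r = 6 * r := by omega
  rw [e] at key
  have l2 : K * (12 * r + W.length) ≤ K * (1404 * r) := Nat.mul_le_mul_left _ (by omega)
  have l3 : (240 * K + 1) * (6 * r) ≤ r * (6 * r) := Nat.mul_le_mul_right _ r3
  have l4 : 0 < r := by omega
  nlinarith

end
end VK

namespace VK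
section
variable {V : Type} {Γ : SimpleGraph V}

theorem tlem (hc : Γ.Connected) {K : ℕ} (hK : Iso Γ K) {u v : ℕ → V} {A B : ℕ}
    (hu : Geo Γ u A) (hv : Geo Γ v B) (h0 : u 0 = v 0)
    (hQ : ∀ i j, i ≤ A → j ≤ B → i + j ≤ 3 * Γ.dist (u i) (v j)) :
    A + B ≤ Γ.dist (u A) (v B) + 2 * (24 * (240 * K + 1)) := by
  classical
  obtain ⟨ρ, ρ0, ρ1, hρ⟩ := exists_geo hc (u A) (v B)
  set N := Γ.dist (u A) (v B) with hN
  have cm : ∀ a b, Γ.dist a b = Γ.dist b a := fun a b => SimpleGraph.dist_comm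
  have hex : ∃ D, (∀ i ≤ A, ∃ k ≤ N, Γ.dist (u i) (ρ k) ≤ D) ∧
      (∀ j ≤ B, ∃ k ≤ N, Γ.dist (v j) (ρ k) ≤ D) := by
    refine ⟨A + B, fun i hi => ⟨0, by omega, ?_⟩, fun j hj => ⟨N, le_rfl, ?_⟩⟩
    · rw [ρ0]; have := hu i A hi le_rfl; omega
    · rw [ρ1]; have := hv j B hj le_rfl; omega
  obtain ⟨s1, s2⟩ := Nat.find_spec hex
  have hmin := fun m hm => Nat.find_min (m := m) hex hm
  set D := Nat.find hex with hDdef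
  have hD : D < 24 * (240 * K + 1) := by
    by_cases hz : D = 0
    · omega
    · have := hmin (D - 1) (by omega)
      rw [not_and_or] at this
      rcases this with h | h
      · push Not at h
        obtain ⟨i, hi, h⟩ := h
        refine Lp hc hK hu hv hρ h0 ρ0 ρ1 hQ s1 s2 hi ?_
        intro k hk; have := h k hk; omega
      · push Not at h
        obtain ⟨i, hi, h⟩ := h
        refine Lp hc hK hv hu (hρ.rev le_rfl) h0.symm (by simpa using ρ1) (by simpa using ρ0)
          (fun i j hi hj => by rw [cm, add_comm]; exact hQ j i hj hi) ?_ ?_ hi ?_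
        · intro j hj
          obtain ⟨k, hk, h1⟩ := s2 j hj
          exact ⟨N - k, by omega, by rw [Nat.sub_sub_self hk]; exact h1⟩
        · intro j hj
          obtain ⟨k, hk, h1⟩ := s1 j hj
          exact ⟨N - k, by omega, by rw [Nat.sub_sub_self hk]; exact h1⟩
        · intro k hk; have := h (N - k) (by omega); omega
  obtain ⟨k, hk, h1⟩ := s1 0 (by omega)
  have t1 := hc.dist_triangle (u := u 0) (v := ρ k) (w := u A)
  have t2 := hc.dist_triangle (u := v 0) (v := ρ k) (w := v B)
  have g1 := hu 0 A (by omega) le_rfl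
  have g2 := hv 0 B (by omega) le_rfl
  have g3 := hρ 0 k (by omega) hk
  have g4 := hρ k N hk le_rfl
  rw [ρ0, cm] at g3
  rw [ρ1] at g4
  rw [← h0] at t2 g2
  omega

theorem proj_lem (hc : Γ.Connected) {K : ℕ} (hK : Iso Γ K) {u : ℕ → V} {A : ℕ}
    (hu : Geo Γ u A) (z : V) (hz : ∀ a ≤ A, Γ.dist z (u 0) ≤ Γ.dist z (u a)) :
    A + Γ.dist z (u 0) ≤ Γ.dist (u A) z + 2 * (24 * (240 * K + 1)) := by
  obtain ⟨v, v0, v1, hv⟩ := exists_geo hc (u 0) z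
  have cm : ∀ a b, Γ.dist a b = Γ.dist b a := fun a b => SimpleGraph.dist_comm
  have := tlem hc hK hu hv v0.symm (by
    intro i j hi hj
    have t1 := hc.dist_triangle (u := z) (v := v j) (w := u i)
    have t2 := hc.dist_triangle (u := u 0) (v := v j) (w := u i)
    have g1 := hv j _ hj le_rfl
    have g2 := hv 0 j (by omega) hj
    have g3 := hu 0 i (by omega) hi
    have h := hz i hi
    rw [v1, cm (v j) z] at g1
    rw [v0] at g2
    rw [cm (v j) (u i)] at t1 t2
    rw [cm z (u 0)] at h
    omega)
  rw [v1, cm (u 0) z] at this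
  exact this

theorem fourpt (hc : Γ.Connected) {K : ℕ} (hK : Iso Γ K) (x y z w : V) :
    Γ.dist x y + Γ.dist z w ≤ max (Γ.dist x z + Γ.dist y w) (Γ.dist x w + Γ.dist y z)
      + 4 * (24 * (240 * K + 1)) := by
  obtain ⟨α, α0, α1, hα⟩ := exists_geo hc x y
  set N := Γ.dist x y with hN
  have cm : ∀ a b, Γ.dist a b = Γ.dist b a := fun a b => SimpleGraph.dist_comm
  have main : ∀ z, ∃ i ≤ N, i + Γ.dist z (α i) ≤ Γ.dist x z + 2 * (24 * (240 * K + 1)) ∧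
      (N - i) + Γ.dist z (α i) ≤ Γ.dist y z + 2 * (24 * (240 * K + 1)) := by
    intro z
    obtain ⟨i, hi, hmin⟩ := Finset.exists_min_image (Finset.range (N + 1))
      (fun i => Γ.dist z (α i)) ⟨0, by simp⟩
    rw [Finset.mem_range] at hi
    refine ⟨i, by omega, ?_, ?_⟩
    · have := proj_lem hc hK (hα.rev (a := i) (by omega)) z (by
        intro a ha
        have := hmin (i - a) (by rw [Finset.mem_range]; omega)
        simpa using this)
      simpa [α0] using this
    · have := proj_lem hc hK (hα.shift (a := i) (m := N - i) (by omega)) z (by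
        intro a ha
        have := hmin (i + a) (by rw [Finset.mem_range]; omega)
        simpa using this)
      have e : i + (N - i) = N := by omega
      simpa [e, α1] using this
  obtain ⟨i, hi, a1, a2⟩ := main z
  obtain ⟨j, hj, b1, b2⟩ := main w
  have t1 := hc.dist_triangle (u := z) (v := α i) (w := w)
  have t2 := hc.dist_triangle (u := α i) (v := α j) (w := w)
  rw [cm (α j) w] at t2
  rcases le_total i j with h | h
  · have := hα i j h hj
    have := le_max_right (Γ.dist x z + Γ.dist y w) (Γ.dist x w + Γ.dist y z)
    omega
  · have := hα j i h hi
    rw [cm] at this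
    have := le_max_left (Γ.dist x z + Γ.dist y w) (Γ.dist x w + Γ.dist y z)
    omega

end
end VK

namespace VK
section
variable {n : ℕ} {M : Fin n → Fin n → ℕ∞}

theorem XX_inv {s : GA n M} (h : s ∈ XX n M) : s⁻¹ ∈ XX n M := by
  rcases h with ⟨q, hq, hs⟩ | ⟨l, rfl⟩
  · exact Or.inl ⟨q, hq, Subgroup.inv_mem _ hs⟩
  · exact Or.inr ⟨ib l, by rw [lt_ib, map_inv]⟩

/-- the graph -/
def Gam (n : ℕ) (M : Fin n → Fin n → ℕ∞) : SimpleGraph (GA n M) where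
  Adj x y := x ≠ y ∧ x⁻¹ * y ∈ XX n M
  symm := ⟨fun x y h => ⟨h.1.symm, by simpa using XX_inv h.2⟩⟩
  loopless := ⟨fun x h => h.1 rfl⟩

theorem Gam_step {x y : GA n M} (h : x⁻¹ * y ∈ XX n M) : x = y ∨ (Gam n M).Adj x y := by
  by_cases e : x = y
  · exact Or.inl e
  · exact Or.inr ⟨e, h⟩

theorem Gam_reach (w : List (Fin n × Bool)) (x : GA n M) :
    (Gam n M).Reachable x (x * artinMk n M (fw w)) := by
  induction w generalizing x with
  | nil => simp [fw_nil]
  | cons l w ih =>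
    have h2 := ih (x * artinMk n M (lt l))
    rw [fw_cons, map_mul, ← mul_assoc]
    refine SimpleGraph.Reachable.trans ?_ h2
    rcases Gam_step (x := x) (y := x * artinMk n M (lt l)) (by rw [inv_mul_cancel_left]; exact Or.inr ⟨l, rfl⟩) with h | h
    · rw [← h]
    · exact h.reachable

theorem Gam_conn : (Gam n M).Connected := by
  have : Nonempty (GA n M) := ⟨1⟩
  refine SimpleGraph.Connected.mk fun x y => ?_
  obtain ⟨z, hz⟩ := PresentedGroup.mk_surjective (artinRels n M) (x⁻¹ * y)
  have h := Gam_reach (M := M) z.toWord x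
  have e : artinMk n M (fw z.toWord) = x⁻¹ * y := by
    rw [fw, FreeGroup.mk_toWord]; exact hz
  rw [e, mul_inv_cancel_left] at h
  exact h

theorem Gam_le_one {x y : GA n M} (h : x⁻¹ * y ∈ XX n M) : (Gam n M).dist x y ≤ 1 := by
  rcases Gam_step h with rfl | h
  · simp
  · exact (SimpleGraph.dist_eq_one_iff_adj.2 h).le

theorem GLip_Lip {f : GA n M → ℝ} (h : GLip (Gam n M) f) : Lip f := by
  intro x s hs
  rcases Gam_step (x := x) (y := x * s) (by rw [inv_mul_cancel_left]; exact hs) with e | e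
  · rw [← e]; simp
  · exact h _ _ e

theorem XX_block {s : GA n M} (h : s ∈ XX n M) : ∃ b : Bl n, Ok M b ∧ val M b = s := by
  rcases h with ⟨q, hq, hs⟩ | ⟨l, rfl⟩
  · obtain ⟨w, hw, e⟩ := HH_exists hs
    exact ⟨(q, w), Or.inl ⟨hq, hw⟩, e⟩
  · exact ⟨({l.1}, [l]), Or.inr ⟨l, rfl⟩, rfl⟩

theorem loop_blocks (f g : GA n M → ℝ) (p : ℕ → GA n M) (L : ℕ)
    (hp : ∀ t < L, (Gam n M).Adj (p t) (p (t + 1))) :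
    ∃ bs : List (Bl n), bs.length = L ∧ (∀ b ∈ bs, Ok M b) ∧
      p 0 * artinMk n M (fw (wd bs)) = p L ∧
      II f g (p 0) bs = ∑ t ∈ Finset.range L, f (p t) * (g (p (t + 1)) - g (p t)) := by
  induction L with
  | zero => exact ⟨[], rfl, by simp, by simp [wd, fw_nil], by simp [II]⟩
  | succ L ih =>
    obtain ⟨bs, h1, h2, h3, h4⟩ := ih fun t ht => hp t (by omega)
    obtain ⟨b, hb, hv⟩ := XX_block (hp L (by omega)).2
    have hv' : artinMk n M (fw b.2) = (p L)⁻¹ * p (L + 1) := hv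
    refine ⟨bs ++ [b], by simp [h1], ?_, ?_, ?_⟩
    · intro c hc
      rcases List.mem_append.1 hc with hc | hc
      · exact h2 c hc
      · rw [List.mem_singleton.1 hc]; exact hb
    · rw [wd_append, fw_append, map_mul, ← mul_assoc, h3]
      have : wd [b] = b.2 := by simp [wd]
      rw [this, hv', mul_inv_cancel_left]
    · rw [II_append, h3, h4, Finset.sum_range_succ, II, II, hv, mul_inv_cancel_left, add_zero]

theorem Gam_iso (hsym : ∀ i j, M i j = M j i) (hM : ∀ i j, i ≠ j → 7 ≤ M i j) :
    Iso (Gam n M) 26 := by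
  intro f g hf hg p L hp hc
  obtain ⟨bs, h1, h2, h3, h4⟩ := loop_blocks f g p L hp
  rw [← h4]
  rcases Nat.eq_zero_or_pos L with h0 | h0
  · subst h0
    rw [List.length_eq_zero_iff.1 h1]; simp [II]
  · rw [← hc] at h3
    have := star hsym hM (GLip_Lip hf) (GLip_Lip hg) L bs h1 h2 (mul_eq_left.1 h3) (p 0) h0
    push_cast
    linarith

theorem par_HH (p : FinitePairs n M) : parabolic n M p = HH n M {p.1.1, p.1.2} := by
  rw [parabolic, HH, MonoidHom.map_closure]
  congr 1
  rw [← Set.image_comp]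
  simp [Set.image_insert_eq]

theorem par_FinQ (hsym : ∀ i j, M i j = M j i) (p : FinitePairs n M) :
    FinQ M {p.1.1, p.1.2} := by
  have h := p.2.2
  have h' := hsym p.1.1 p.1.2
  refine ⟨Finset.card_pair p.2.1.ne, ?_⟩
  intro i hi j hj hij
  simp only [Finset.mem_insert, Finset.mem_singleton] at hi hj
  rcases hi with rfl | rfl <;> rcases hj with rfl | rfl
  · exact absurd rfl hij
  · exact h
  · rw [← h']; exact h
  · exact absurd rfl hij

theorem FinQ_par {q : Finset (Fin n)} (h : FinQ M q) :
    ∃ p : FinitePairs n M, HH n M q = parabolic n M p := by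
  obtain ⟨i, j, hij, rfl⟩ := Finset.card_eq_two.1 h.1
  rcases lt_or_gt_of_ne hij with hl | hl
  · have h2 : M i j ≠ ⊤ := h.2 i (by simp) j (by simp) hij
    let p : FinitePairs n M := ⟨(i, j), hl, h2⟩
    exact ⟨p, (par_HH p).symm⟩
  · have h2 : M j i ≠ ⊤ := h.2 j (by simp) i (by simp) hij.symm
    let p : FinitePairs n M := ⟨(j, i), hl, h2⟩
    refine ⟨p, ?_⟩
    rw [Finset.pair_comm]
    exact (par_HH p).symm

/-- vertices -/
abbrev CV (n : ℕ) (M : Fin n → Fin n → ℕ∞) := ConedVert (GA n M) (parabolic n M)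
/-- generators -/
abbrev AA (n : ℕ) (M : Fin n → Fin n → ℕ∞) : Set (GA n M) :=
  Set.range fun i => artinMk n M (FreeGroup.of i)

/-- representative relation -/
def Nr : CV n M → GA n M → Prop
  | .grp g, u => u = g
  | .cone i c, u => (QuotientGroup.mk u : GA n M ⧸ parabolic n M i) = c

/-- correction -/
noncomputable def kap : CV n M → ℝ
  | .grp _ => 0
  | .cone _ _ => 1 / 2

theorem Nr_exists (v : CV n M) : ∃ u, Nr v u := by
  cases v with
  | grp g => exact ⟨g, rfl⟩
  | cone i c => exact ⟨c.out, QuotientGroup.out_eq' c⟩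

theorem kap_nonneg (v : CV n M) : 0 ≤ kap v := by cases v <;> simp [kap]
theorem kap_le (v : CV n M) : kap v ≤ 1 / 2 := by cases v <;> simp [kap]

theorem coset_dist (hsym : ∀ i j, M i j = M j i) {i : FinitePairs n M}
    {c : GA n M ⧸ parabolic n M i} {u u' : GA n M}
    (h : (QuotientGroup.mk u : GA n M ⧸ parabolic n M i) = c)
    (h' : (QuotientGroup.mk u' : GA n M ⧸ parabolic n M i) = c) :
    (Gam n M).dist u u' ≤ 1 := by
  apply Gam_le_one
  have := QuotientGroup.eq.1 (h.trans h'.symm)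
  rw [par_HH] at this
  exact Or.inl ⟨_, par_FinQ hsym i, this⟩

theorem gen_dist {g g' : GA n M} (h : ∃ a ∈ AA n M, g' = g * a ∨ g = g' * a) :
    (Gam n M).dist g g' ≤ 1 := by
  obtain ⟨a, ⟨i, rfl⟩, h⟩ := h
  have hx : artinMk n M (FreeGroup.of i) ∈ XX n M := Or.inr ⟨(i, true), rfl⟩
  rcases h with rfl | rfl
  · apply Gam_le_one; simpa using hx
  · apply Gam_le_one; simpa using XX_inv hx

theorem lower (hsym : ∀ i j, M i j = M j i) (p : List (CV n M)) : ∀ (v w : CV n M),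
    IsPathFrom (conedAdj (AA n M) (parabolic n M)) p v w → ∀ u u', Nr v u → Nr w u' →
    ((Gam n M).dist u u' : ℝ) ≤ pathCost (conedWt (parabolic n M)) p + kap v + kap w := by
  induction p with
  | nil => intro v w h; simp [IsPathFrom] at h
  | cons x l ih =>
    intro v w h u u' hu hu'
    obtain ⟨h1, h2, h3⟩ := h
    have e1 : x = v := by simpa using h1
    subst e1
    cases l with
    | nil =>
      have e2 : x = w := by simpa using h2
      subst e2
      cases x with
      | grp g =>
        have e3 : u = g := hu
        have e4 : u' = g := hu'
        subst e3 e4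
        simp [pathCost, kap]
      | cone i c =>
        have := coset_dist hsym hu hu'
        have : ((Gam n M).dist u u' : ℝ) ≤ 1 := by exact_mod_cast this
        simp only [pathCost, kap]; linarith
    | cons y l =>
      have hadj : conedAdj (AA n M) (parabolic n M) x y := (List.isChain_cons_cons.1 h3).1
      have hp : IsPathFrom (conedAdj (AA n M) (parabolic n M)) (y :: l) y w :=
        ⟨rfl, by simpa using h2, (List.isChain_cons_cons.1 h3).2⟩
      have ih := ih y w hp
      rw [pathCost]
      cases x with
      | grp g =>
        have e3 : u = g := hu
        subst e3
        cases y with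
        | grp g' =>
          have a1 : ((Gam n M).dist u g' : ℝ) ≤ 1 := by exact_mod_cast gen_dist hadj
          have a2 := ih g' u' rfl hu'
          have a3 : ((Gam n M).dist u u' : ℝ) ≤ (Gam n M).dist u g' + (Gam n M).dist g' u' := by
            exact_mod_cast Gam_conn.dist_triangle
          simp only [kap, conedWt] at *
          linarith
        | cone i c =>
          have a2 := ih u u' hadj hu'
          simp only [kap, conedWt] at *
          linarith
      | cone i c =>
        cases y with
        | grp g' =>
          have a1 : ((Gam n M).dist u g' : ℝ) ≤ 1 := by exact_mod_cast coset_dist hsym hu hadj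
          have a2 := ih g' u' rfl hu'
          have a3 : ((Gam n M).dist u u' : ℝ) ≤ (Gam n M).dist u g' + (Gam n M).dist g' u' := by
            exact_mod_cast Gam_conn.dist_triangle
          simp only [kap, conedWt] at *
          linarith
        | cone i c => exact hadj.elim

/-- path with cost at most c -/
def PP (v w : CV n M) (c : ℝ) : Prop :=
  ∃ p, IsPathFrom (conedAdj (AA n M) (parabolic n M)) p v w ∧
    pathCost (conedWt (parabolic n M)) p ≤ c

theorem PP_refl (v : CV n M) : PP v v 0 :=
  ⟨[v], ⟨rfl, rfl, List.isChain_singleton _⟩, le_of_eq rfl⟩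

theorem PP_cons {v y w : CV n M} {c : ℝ} (h : conedAdj (AA n M) (parabolic n M) v y)
    (hp : PP y w c) : PP v w (conedWt (parabolic n M) v y + c) := by
  obtain ⟨p, ⟨h1, h2, h3⟩, h4⟩ := hp
  cases p with
  | nil => simp at h1
  | cons x l =>
    have : x = y := by simpa using h1
    subst this
    refine ⟨v :: x :: l, ⟨rfl, by simpa using h2, List.isChain_cons_cons.2 ⟨h, h3⟩⟩, ?_⟩
    rw [pathCost]; linarith

theorem PP_adj {x y : GA n M} {w : CV n M} {c : ℝ} (h : (Gam n M).Adj x y)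
    (hp : PP (.grp y) w c) : PP (.grp x) w (c + 1) := by
  rcases h.2 with ⟨q, hq, hs⟩ | ⟨l, hl⟩
  · obtain ⟨i, hi⟩ := FinQ_par hq
    rw [hi] at hs
    have a1 : PP (.cone i (QuotientGroup.mk y)) w _ := PP_cons (by exact rfl) hp
    have a2 : PP (.grp x) w _ := PP_cons (by exact QuotientGroup.eq.2 hs) a1
    have e : c + 1 = 1 / 2 + (1 / 2 + c) := by ring
    rw [e]; exact a2
  · have e : c + 1 = 1 + c := by ring
    rw [e]
    refine PP_cons (y := .grp y) ?_ hp
    rcases l with ⟨i, b⟩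
    refine ⟨artinMk n M (FreeGroup.of i), ⟨i, rfl⟩, ?_⟩
    cases b
    · right
      have : lt (i, false) = (lt (i, true))⁻¹ := lt_ib (i, true)
      rw [this, map_inv] at hl
      have : artinMk n M (FreeGroup.of i) = (x⁻¹ * y)⁻¹ := by rw [hl, inv_inv]; rfl
      rw [this]; group
    · left
      have : artinMk n M (FreeGroup.of i) = x⁻¹ * y := hl.symm
      rw [this]; group

theorem PP_walk {x y : GA n M} (W : (Gam n M).Walk x y) {w : CV n M} {c : ℝ}
    (hp : PP (.grp y) w c) : PP (.grp x) w (c + W.length) := by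
  induction W with
  | nil => simpa using hp
  | cons h W ih =>
    have := PP_adj h (ih hp)
    rw [SimpleGraph.Walk.length_cons]
    push_cast
    rw [← add_assoc]; exact this

theorem upper {v w : CV n M} {u u' : GA n M} (hu : Nr v u) (hu' : Nr w u') :
    PP v w (kap v + ((Gam n M).dist u u' + kap w)) := by
  have a1 : PP (.grp u') w (kap w) := by
    cases w with
    | grp g => have e : u' = g := hu'; subst e; exact PP_refl _
    | cone i c =>
      have : PP (.grp u') (.cone i c : CV n M) _ := PP_cons (by exact hu') (PP_refl _)
      have e : kap (.cone i c : CV n M) = 1 / 2 + 0 := by simp [kap]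
      rw [e]; exact this
  obtain ⟨W, hW⟩ := Gam_conn.exists_walk_length_eq_dist u u'
  have a2 := PP_walk W a1
  rw [hW, add_comm] at a2
  cases v with
  | grp g => have e : u = g := hu; subst e; rw [kap, zero_add]; exact a2
  | cone i c => exact PP_cons (by exact hu) a2

theorem cone_bounds (hsym : ∀ i j, M i j = M j i) {v w : CV n M} {u u' : GA n M}
    (hu : Nr v u) (hu' : Nr w u') :
    ((Gam n M).dist u u' : ℝ) - 1 ≤ conedDist (AA n M) (parabolic n M) v w ∧
    conedDist (AA n M) (parabolic n M) v w ≤ (Gam n M).dist u u' + 1 := by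
  have k1 := kap_le v
  have k2 := kap_le w
  have hb : ∀ c ∈ { c | ∃ p, IsPathFrom (conedAdj (AA n M) (parabolic n M)) p v w ∧
      pathCost (conedWt (parabolic n M)) p = c }, ((Gam n M).dist u u' : ℝ) - 1 ≤ c := by
    rintro c ⟨p, hp, rfl⟩
    have := lower hsym p v w hp u u' hu hu'
    linarith
  obtain ⟨p, hp, hc⟩ := upper hu hu'
  constructor
  · exact le_csInf ⟨_, p, hp, rfl⟩ hb
  · have : conedDist (AA n M) (parabolic n M) v w ≤ _ := csInf_le ⟨_, hb⟩ ⟨p, hp, rfl⟩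
    linarith

theorem main (hsym : ∀ i j, M i j = M j i) (hM : ∀ i j, i ≠ j → 7 ≤ M i j) :
    IsGromovHyperbolicDist (conedDist (AA n M) (parabolic n M)) := by
  refine ⟨((4 * (24 * (240 * 26 + 1)) : ℕ) : ℝ) + 4, by positivity, fun x y z w => ?_⟩
  obtain ⟨a, ha⟩ := Nr_exists x
  obtain ⟨b, hb⟩ := Nr_exists y
  obtain ⟨c, hc⟩ := Nr_exists z
  obtain ⟨d, hd⟩ := Nr_exists w
  have h : (((Gam n M).dist a b + (Gam n M).dist c d : ℕ) : ℝ) ≤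
    ((max ((Gam n M).dist a c + (Gam n M).dist b d) ((Gam n M).dist a d + (Gam n M).dist b c)
      + 4 * (24 * (240 * 26 + 1)) : ℕ) : ℝ) :=
    Nat.cast_le.2 (fourpt Gam_conn (Gam_iso hsym hM) a b c d)
  rw [Nat.cast_add, Nat.cast_add _ (4 * (24 * (240 * 26 + 1))), Nat.cast_max, Nat.cast_add, Nat.cast_add] at h
  have h1 := (cone_bounds hsym ha hb).2
  have h2 := (cone_bounds hsym hc hd).2
  have h3 := (cone_bounds hsym ha hc).1
  have h4 := (cone_bounds hsym hb hd).1
  have h5 := (cone_bounds hsym ha hd).1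
  have h6 := (cone_bounds hsym hb hc).1
  rcases max_choice (((Gam n M).dist a c : ℝ) + (Gam n M).dist b d) (((Gam n M).dist a d : ℝ) + (Gam n M).dist b c) with e | e
  · rw [e] at h
    have := le_max_left (conedDist (AA n M) (parabolic n M) x z + conedDist (AA n M) (parabolic n M) y w) (conedDist (AA n M) (parabolic n M) x w + conedDist (AA n M) (parabolic n M) y z)
    linarith
  · rw [e] at h
    have := le_max_right (conedDist (AA n M) (parabolic n M) x z + conedDist (AA n M) (parabolic n M) y w) (conedDist (AA n M) (parabolic n M) x w + conedDist (AA n M) (parabolic n M) y z)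
    linarith

end
end VK

/-- (Main theorem.) An Artin group all of whose labels satisfy `m_{ij} ≥ 7` is
relatively hyperbolic in the sense of Farb with respect to the collection of its
two-generator parabolic subgroups `G_{ij}` with `m_{ij} < ∞`: the coned-off
Cayley graph is a Gromov-hyperbolic metric space. -/
theorem artin_relatively_hyperbolic (n : ℕ) (M : Fin n → Fin n → ℕ∞)
    (hsym : ∀ i j, M i j = M j i) (hM : ∀ i j, i ≠ j → 7 ≤ M i j) :
    IsGromovHyperbolicDist
      (conedDist (Set.range fun i => artinMk n M (FreeGroup.of i))
        (parabolic n M)) := by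
  exact VK.main hsym hM
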